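/- arXiv:math/9201230 — 2 statements merged into one kernel-verified Lean document; each statement's English description precedes it below -/
import Mathlib

section
/- Let (e_i) be a shrinking normalized unconditional basic sequence in a Banach space, and let X = J(e_i) be the James-type space over (e_i) with canonical basis (u_i), biorthogonal functionals (u_i') and summing functional S. Suppose there exist a closed subspace Y of X and a bounded linear operator T : Y → X' which is not compact. Then there exist semi-normalized block bases (x_i) of (u_i) in X and (x_i') of (u_i') in X' such that (x_i) dominates (x_i') and S(x_i) = 0 for all i. -/
open Filter Topology

noncomputable section

/-- An operator between normed spaces is *weakly compact* if the image of the closed unit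
ball is relatively compact in the weak topology of the codomain. -/
def IsWeaklyCompactOperator {X Y : Type*} [NormedAddCommGroup X] [NormedSpace ℝ X]
    [NormedAddCommGroup Y] [NormedSpace ℝ Y] (T : X →L[ℝ] Y) : Prop :=
  IsCompact (closure (toWeakSpace ℝ Y '' (T '' Metric.closedBall 0 1)))

/-- An operator between normed spaces is *compact* if the image of the closed unit ball is
relatively norm-compact. -/
def IsCompactOp {X Y : Type*} [NormedAddCommGroup X] [NormedSpace ℝ X]
    [NormedAddCommGroup Y] [NormedSpace ℝ Y] (T : X →L[ℝ] Y) : Prop :=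
  IsCompact (closure (T '' Metric.closedBall 0 1))

/-- A Banach space has *Property (w)* if every operator into its dual is weakly compact. -/
def PropertyW (X : Type*) [NormedAddCommGroup X] [NormedSpace ℝ X] : Prop :=
  ∀ T : X →L[ℝ] (X →L[ℝ] ℝ), IsWeaklyCompactOperator T

/-- A normed space is *weakly sequentially complete* if every weakly Cauchy sequence is
weakly convergent. -/
def WeaklySeqComplete (X : Type*) [NormedAddCommGroup X] [NormedSpace ℝ X] : Prop :=
  ∀ x : ℕ → X,
    (∀ f : X →L[ℝ] ℝ, ∃ L : ℝ, Tendsto (fun n => f (x n)) atTop (𝓝 L)) →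
    ∃ x₀ : X, ∀ f : X →L[ℝ] ℝ, Tendsto (fun n => f (x n)) atTop (𝓝 (f x₀))

/-- A normed space is reflexive if the canonical embedding into the double dual is
surjective. -/
def IsReflexiveSpace (X : Type*) [NormedAddCommGroup X] [NormedSpace ℝ X] : Prop :=
  Function.Surjective (NormedSpace.inclusionInDoubleDual ℝ X)

/-- `(e i)` is a normalized unconditional basic sequence. -/
def IsNormalizedUnconditionalBasic {E : Type*} [NormedAddCommGroup E] [NormedSpace ℝ E]
    (e : ℕ → E) : Prop :=
  (∀ i, ‖e i‖ = 1) ∧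
  ∃ C : ℝ, ∀ S F : Finset ℕ, S ⊆ F → ∀ a : ℕ → ℝ,
    ‖∑ i ∈ S, a i • e i‖ ≤ C * ‖∑ i ∈ F, a i • e i‖

/-- `(x i)` dominates `(y i)`. -/
def Dominates {X Y : Type*} [NormedAddCommGroup X] [NormedSpace ℝ X]
    [NormedAddCommGroup Y] [NormedSpace ℝ Y] (x : ℕ → X) (y : ℕ → Y) : Prop :=
  ∃ C : ℝ, ∀ (s : Finset ℕ) (a : ℕ → ℝ),
    ‖∑ i ∈ s, a i • y i‖ ≤ C * ‖∑ i ∈ s, a i • x i‖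

/-- Two sequences are equivalent if each dominates the other. -/
def EquivalentSeq {X Y : Type*} [NormedAddCommGroup X] [NormedSpace ℝ X]
    [NormedAddCommGroup Y] [NormedSpace ℝ Y] (x : ℕ → X) (y : ℕ → Y) : Prop :=
  Dominates x y ∧ Dominates y x

/-- `(v n)` is a block basis of `(e i)`. -/
def IsBlockBasis {E : Type*} [NormedAddCommGroup E] [NormedSpace ℝ E]
    (e v : ℕ → E) : Prop :=
  ∃ q : ℕ → ℕ, StrictMono q ∧ ∃ a : ℕ → ℝ,
    ∀ n, v n ≠ 0 ∧ v n = ∑ i ∈ Finset.Ico (q n) (q (n + 1)), a i • e i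

/-- A sequence is semi-normalized. -/
def SemiNormalized {E : Type*} [NormedAddCommGroup E] (x : ℕ → E) : Prop :=
  ∃ c C : ℝ, 0 < c ∧ ∀ i, c ≤ ‖x i‖ ∧ ‖x i‖ ≤ C

/-- `(e i)` is right dominant. -/
def RightDominantBound {E : Type*} [NormedAddCommGroup E] [NormedSpace ℝ E]
    (e : ℕ → E) : Prop :=
  ∃ C : ℝ, ∀ m n : ℕ → ℕ, (∀ i, m i ≤ n i) → (∀ i, n i < m (i + 1)) →
    ∀ (s : Finset ℕ) (a : ℕ → ℝ),
      ‖∑ i ∈ s, a i • e (m i)‖ ≤ C * ‖∑ i ∈ s, a i • e (n i)‖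

/-- The James norm associated to `(e i)` of a (finitely supported) scalar sequence. -/
def jamesNorm {E : Type*} [NormedAddCommGroup E] [NormedSpace ℝ E]
    (e : ℕ → E) (a : ℕ → ℝ) : ℝ :=
  sSup { x : ℝ | ∃ (k : ℕ) (p : ℕ → ℕ), 0 < k ∧ p 0 = 0 ∧ StrictMono p ∧
    x = ‖∑ i ∈ Finset.range k, (∑ j ∈ Finset.Ico (p i) (p (i + 1)), a j) • e (p i)‖ }

/-- `X`, together with the sequence `(u i)`, is the James-type space over `(e i)`. -/
def IsJamesSpace {E X : Type*} [NormedAddCommGroup E] [NormedSpace ℝ E]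
    [NormedAddCommGroup X] [NormedSpace ℝ X] (e : ℕ → E) (u : ℕ → X) : Prop :=
  Dense (Submodule.span ℝ (Set.range u) : Set X) ∧
  ∀ a : ℕ →₀ ℝ, ‖∑ i ∈ a.support, a i • u i‖ = jamesNorm e (a : ℕ → ℝ)

/-- `(e i)` is shrinking: the span of the biorthogonal functionals is dense in the dual of
the closed linear span of `(e i)`. -/
def IsShrinking {E : Type*} [NormedAddCommGroup E] [NormedSpace ℝ E] (e : ℕ → E) : Prop :=
  ∃ e' : ℕ → ((Submodule.span ℝ (Set.range e)).topologicalClosure →L[ℝ] ℝ),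
    (∀ i j, e' i ⟨e j, Submodule.le_topologicalClosure _
        (Submodule.subset_span (Set.mem_range_self j))⟩ = if i = j then 1 else 0) ∧
    Dense (Submodule.span ℝ (Set.range e') :
      Set ((Submodule.span ℝ (Set.range e)).topologicalClosure →L[ℝ] ℝ))

/-- `E` satisfies an upper `p`-estimate with respect to the unconditional basis `(e i)`. -/
def UpperPEstimate {E : Type*} [NormedAddCommGroup E] [NormedSpace ℝ E]
    (e : ℕ → E) (p : ℝ) : Prop :=
  ∃ C : ℝ, ∀ (n : ℕ) (x : ℕ → E) (s : ℕ → Finset ℕ) (a : ℕ → ℕ → ℝ),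
    (∀ k, k < n → x k = ∑ i ∈ s k, a k i • e i) →
    (∀ k l, k < n → l < n → k ≠ l → Disjoint (s k) (s l)) →
    ‖∑ k ∈ Finset.range n, x k‖ ≤ C * (∑ k ∈ Finset.range n, ‖x k‖ ^ p) ^ (1 / p)

/-- `(e i)` is subsymmetric: unconditional and equivalent to all of its subsequences. -/
def IsSubsymmetric {E : Type*} [NormedAddCommGroup E] [NormedSpace ℝ E] (e : ℕ → E) : Prop :=
  (∃ C : ℝ, ∀ S F : Finset ℕ, S ⊆ F → ∀ a : ℕ → ℝ,
    ‖∑ i ∈ S, a i • e i‖ ≤ C * ‖∑ i ∈ F, a i • e i‖) ∧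
  ∀ φ : ℕ → ℕ, StrictMono φ → EquivalentSeq e (e ∘ φ)

/-- `(e i)` is a symmetric basic sequence: equivalent to all of its permutations. -/
def IsSymmetricSeq {E : Type*} [NormedAddCommGroup E] [NormedSpace ℝ E] (e : ℕ → E) : Prop :=
  ∀ σ : Equiv.Perm ℕ, EquivalentSeq e (fun i => e (σ i))

/-- A topological space is scattered if every nonempty closed subset has a point isolated
in that subset. -/
def Scattered (K : Type*) [TopologicalSpace K] : Prop :=
  ∀ C : Set K, C.Nonempty → IsClosed C → ∃ x ∈ C, ∃ U : Set K, IsOpen U ∧ U ∩ C = {x}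

end



lemma ptak {K : Type*} [TopologicalSpace K] [CompactSpace K] [T2Space K]
    (g : ℕ → C(K, ℝ)) (M : ℝ) (hM : ∀ n k, |g n k| ≤ M)
    (h0 : ∀ k, Tendsto (fun n => g n k) atTop (𝓝 0)) (ε : ℝ) (hε : 0 < ε) :
    ∃ h ∈ convexHull ℝ (Set.range g), ∀ k, h k < ε := by
  by_contra hcon
  push Not at hcon
  let B : Set C(K, ℝ) := {h | Set.MapsTo h Set.univ (Set.Iio ε)}
  have hBo : IsOpen B := ContinuousMap.isOpen_setOfPred_mapsTo isCompact_univ isOpen_Iio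
  have hBmem : ∀ h : C(K, ℝ), h ∈ B ↔ ∀ k, h k < ε := by
    intro h
    simp [B, Set.MapsTo]
  have hBc : Convex ℝ B := by
    intro x hx y hy a b ha hb hab
    rw [hBmem] at *
    intro k
    have := hx k
    have := hy k
    exact (convex_Iio (𝕜 := ℝ) ε) (hx k) (hy k) ha hb hab
  have hdisj : Disjoint B (convexHull ℝ (Set.range g)) := by
    rw [Set.disjoint_left]
    intro h hB hA
    obtain ⟨k, hk⟩ := hcon h hA
    exact absurd ((hBmem h).1 hB k) (not_lt.2 hk)
  obtain ⟨f, c, h1, h2⟩ := geometric_hahn_banach_open hBc hBo (convex_convexHull ℝ _) hdisj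
  have hc : 0 < c := by
    have := h1 0 ((hBmem 0).2 (fun k => by simpa using hε))
    simpa using this
  have hpos : ∀ h : C(K, ℝ), (∀ k, 0 ≤ h k) → 0 ≤ f h := by
    intro h hh
    by_contra hneg
    push Not at hneg
    have h3 := h1 ((c / f h) • h) ((hBmem _).2 (fun k => by
      have : (c / f h) * h k ≤ 0 :=
        mul_nonpos_of_nonpos_of_nonneg (div_nonpos_of_nonneg_of_nonpos hc.le hneg.le) (hh k)
      simpa using lt_of_le_of_lt this hε))
    rw [map_smul, smul_eq_mul, div_mul_cancel₀ _ hneg.ne] at h3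
    exact lt_irrefl _ h3
  letI : MeasurableSpace K := borel K
  haveI : BorelSpace K := ⟨rfl⟩
  let L0 : CompactlySupportedContinuousMap K ℝ →ₗ[ℝ] ℝ :=
    { toFun := fun h => f (h : C(K, ℝ))
      map_add' := fun x y => by
        rw [← map_add]; rfl
      map_smul' := fun a x => by
        rw [RingHom.id_apply, ← map_smul]; rfl }
  let L : CompactlySupportedContinuousMap K ℝ →ₚ[ℝ] ℝ :=
    PositiveLinearMap.mk₀ L0 (fun x hx => hpos _ (fun k => hx k))
  let μ := RealRMK.rieszMeasure L
  have hfin : MeasureTheory.IsFiniteMeasure μ := by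
    constructor
    exact isCompact_univ.measure_lt_top
  have key : ∀ n, ∫ k, g n k ∂μ = f (g n) := by
    intro n
    exact RealRMK.integral_rieszMeasure L (CompactlySupportedContinuousMap.continuousMapEquiv (g n))
  have hlim : Tendsto (fun n => ∫ k, g n k ∂μ) atTop (𝓝 (∫ k, (0:ℝ) ∂μ)) := by
    apply MeasureTheory.tendsto_integral_of_dominated_convergence (fun _ => M)
    · intro n
      exact (g n).continuous.measurable.aestronglyMeasurable
    · exact MeasureTheory.integrable_const M
    · intro n
      exact Eventually.of_forall (fun k => hM n k)
    · exact Eventually.of_forall h0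
  simp only [key, MeasureTheory.integral_zero] at hlim
  have := ge_of_tendsto' hlim (fun n => h2 (g n) (subset_convexHull ℝ _ ⟨n, rfl⟩))
  linarith


def lst (D : ℕ → Bool) : ℕ → ℕ
  | 0 => 0
  | (j+1) => if D (j+1) then j+1 else lst D j

lemma lst_le (D : ℕ → Bool) (j : ℕ) : lst D j ≤ j := by
  induction j with
  | zero => simp [lst]
  | succ j ih => rw [lst]; split_ifs <;> omega

lemma lst_eq (D : ℕ → Bool) (j m : ℕ) (hm : m ≤ j) (h0 : m = 0 ∨ D m = true)
    (h : ∀ i, m < i → i ≤ j → D i = false) : lst D j = m := by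
  induction j with
  | zero => simp [lst]; omega
  | succ j ih =>
    rw [lst]
    rcases Nat.lt_or_ge m (j+1) with h1 | h1
    · rw [if_neg (by simp [h (j+1) h1 le_rfl])]
      exact ih (by omega) (fun i hi hij => h i hi (by omega))
    · have : m = j + 1 := by omega
      subst this
      simp at h0
      simp [h0]

lemma lst_congr (D D' : ℕ → Bool) (j : ℕ) (h : ∀ i, i ≤ j → D i = D' i) : lst D j = lst D' j := by
  induction j with
  | zero => simp [lst]
  | succ j ih => rw [lst, lst, h (j+1) le_rfl, ih (fun i hi => h i (by omega))]

lemma le_lst (D : ℕ → Bool) (j m : ℕ) (hm : m ≤ j) (h : D m = true) : m ≤ lst D j := by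
  induction j with
  | zero => omega
  | succ j ih =>
    rw [lst]
    split_ifs with h1
    · exact hm
    · rcases Nat.lt_or_ge m (j+1) with h2 | h2
      · exact ih (by omega)
      · have : m = j + 1 := by omega
        subst this
        exact absurd h h1

section
variable {E : Type*} [NormedAddCommGroup E] [NormedSpace ℝ E]

def LL (e : ℕ → E) (a : ℕ → ℝ) (D : ℕ → Bool) (n : ℕ) : E :=
  ∑ j ∈ Finset.range n, a j • e (lst D j)

lemma LL_congr (e : ℕ → E) (a a' : ℕ → ℝ) (D D' : ℕ → Bool) (n : ℕ) (h : ∀ i, i < n → D i = D' i)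
    (ha : ∀ i, i < n → a i = a' i) :
    LL e a D n = LL e a' D' n := by
  apply Finset.sum_congr rfl
  intro j hj
  have hj := Finset.mem_range.1 hj
  rw [lst_congr D D' j (fun i hi => h i (by omega)), ha j hj]

open Classical in
lemma part_eq (e : ℕ → E) (a : ℕ → ℝ) (p : ℕ → ℕ) (hp0 : p 0 = 0) (hp : StrictMono p) (k : ℕ) :
    ∑ i ∈ Finset.range k, (∑ j ∈ Finset.Ico (p i) (p (i + 1)), a j) • e (p i)
      = LL e a (fun i => decide (i ∈ Set.range p)) (p k) := by
  induction k with
  | zero => simp [LL, hp0]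
  | succ k ih =>
    rw [Finset.sum_range_succ, ih, LL, LL, ← Finset.sum_range_add_sum_Ico _ (hp (Nat.lt_succ_self k)).le,
      Finset.sum_smul]
    congr 1
    apply Finset.sum_congr rfl
    intro j hj
    rw [Finset.mem_Ico] at hj
    rw [lst_eq _ j (p k) hj.1 (by simp)]
    intro i hi hij
    simp only [decide_eq_false_iff_not]
    rintro ⟨l, rfl⟩
    have h1 := hp.lt_iff_lt.1 hi
    have h2 := hp.lt_iff_lt.1 (lt_of_le_of_lt hij hj.2)
    omega

lemma part_exists (e : ℕ → E) (a : ℕ → ℝ) (D : ℕ → Bool) (n : ℕ) (hn : 0 < n) :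
    ∃ (k : ℕ) (p : ℕ → ℕ), 0 < k ∧ p 0 = 0 ∧ StrictMono p ∧
    LL e a D n = ∑ i ∈ Finset.range k, (∑ j ∈ Finset.Ico (p i) (p (i + 1)), a j) • e (p i) := by
  classical
  let Q : ℕ → Prop := fun i => i = 0 ∨ D i = true ∨ n ≤ i
  have hinf : (Set.ofPred Q).Infinite := by
    apply Set.infinite_of_not_bddAbove
    rintro ⟨b, hb⟩
    have : max n (b+1) ≤ b := hb (show Q _ from Or.inr (Or.inr (le_max_left _ _)))
    omega
  have hmono := Nat.nth_strictMono hinf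
  have h0 : Nat.nth Q 0 = 0 := Nat.nth_zero_of_zero (Or.inl rfl)
  have hr : Set.range (Nat.nth Q) = Set.ofPred Q := Nat.range_nth_of_infinite hinf
  have hnQ : n ∈ Set.range (Nat.nth Q) := by rw [hr]; exact Or.inr (Or.inr le_rfl)
  obtain ⟨k, hk⟩ := hnQ
  refine ⟨k, Nat.nth Q, ?_, h0, hmono, ?_⟩
  · rcases Nat.eq_zero_or_pos k with h | h
    · subst h; omega
    · exact h
  · rw [part_eq e a _ h0 hmono k, hk]
    apply Finset.sum_congr rfl
    intro j hj
    replace hj := Finset.mem_range.1 hj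
    congr 2
    have h3 : ∀ i, i ≤ j → 0 < i → decide (i ∈ Set.range (Nat.nth Q)) = D i := by
      intro i hi h0
      rw [hr]
      have : i ∈ Set.ofPred Q ↔ D i = true := by
        show (i = 0 ∨ D i = true ∨ n ≤ i) ↔ _
        constructor
        · rintro (h | h | h)
          · omega
          · exact h
          · omega
        · intro h; exact Or.inr (Or.inl h)
      by_cases hD : D i = true
      · rw [hD]; simpa using this.2 hD
      · rw [Bool.not_eq_true] at hD
        rw [hD]
        simp only [decide_eq_false_iff_not]
        rw [this, hD]; simp
    clear hk hj
    induction j with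
    | zero => simp [lst]
    | succ j ih =>
      rw [lst, lst, h3 (j+1) le_rfl (by omega), ih (fun i hi h => h3 i (by omega) h)]

lemma LL_norm_le (e : ℕ → E) (he : ∀ i, ‖e i‖ = 1) (a : ℕ → ℝ) (D n) :
    ‖LL e a D n‖ ≤ ∑ j ∈ Finset.range n, |a j| := by
  refine (norm_sum_le _ _).trans (Finset.sum_le_sum fun j _ => ?_)
  rw [norm_smul, he, mul_one, Real.norm_eq_abs]

/-- basic two-sided description -/
lemma james_desc {X : Type*} [NormedAddCommGroup X] [NormedSpace ℝ X] (e : ℕ → E)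
    (he : ∀ i, ‖e i‖ = 1) (u : ℕ → X)
    (hJ : ∀ a : ℕ →₀ ℝ, ‖∑ i ∈ a.support, a i • u i‖ = jamesNorm e (a : ℕ → ℝ))
    (a : ℕ → ℝ) (N : ℕ) :
    (∀ D n, n ≤ N → ‖LL e a D n‖ ≤ ‖∑ j ∈ Finset.range N, a j • u j‖) ∧
    (∀ B, (∀ D n, n ≤ N → ‖LL e a D n‖ ≤ B) → ‖∑ j ∈ Finset.range N, a j • u j‖ ≤ B) := by
  classical
  let b : ℕ →₀ ℝ := Finsupp.onFinset (Finset.range N) (fun j => if j < N then a j else 0)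
    (by intro j hj; by_contra h; simp at h; simp [not_lt.2 h] at hj)
  have hb : ∀ j, b j = if j < N then a j else 0 := fun j => rfl
  have hsum : ∑ i ∈ b.support, b i • u i = ∑ j ∈ Finset.range N, a j • u j := by
    rw [Finset.sum_subset (s₂ := Finset.range N) Finsupp.support_onFinset_subset]
    · apply Finset.sum_congr rfl
      intro j hj
      rw [hb, if_pos (Finset.mem_range.1 hj)]
    · intro j _ hj
      rw [Finsupp.notMem_support_iff.1 hj, zero_smul]
  have hnorm := hJ b
  rw [hsum] at hnorm
  rw [hnorm]
  have hLb : ∀ D n, LL e b D n = LL e a D (min n N) := by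
    intro D n
    rcases le_total n N with h | h
    · rw [min_eq_left h]
      exact LL_congr _ _ _ _ _ _ (fun _ _ => rfl) (fun i hi => by rw [hb, if_pos (by omega)])
    · rw [min_eq_right h, LL, LL, ← Finset.sum_range_add_sum_Ico _ h, Finset.sum_eq_zero (s := Finset.Ico N n), add_zero]
      · apply Finset.sum_congr rfl
        intro j hj
        rw [hb, if_pos (Finset.mem_range.1 hj)]
      · intro j hj
        rw [hb, if_neg (by simp at hj; omega), zero_smul]
  have hbd : BddAbove { x : ℝ | ∃ (k : ℕ) (p : ℕ → ℕ), 0 < k ∧ p 0 = 0 ∧ StrictMono p ∧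
    x = ‖∑ i ∈ Finset.range k, (∑ j ∈ Finset.Ico (p i) (p (i + 1)), b j) • e (p i)‖ } := by
    refine ⟨∑ j ∈ Finset.range N, |a j|, ?_⟩
    rintro x ⟨k, p, hk, hp0, hp, rfl⟩
    rw [part_eq e b p hp0 hp k, hLb]
    refine (LL_norm_le e he _ _ _).trans ?_
    apply Finset.sum_le_sum_of_subset_of_nonneg
    · intro j; simp
    · intros; exact abs_nonneg _
  constructor
  · intro D n hn
    rcases Nat.eq_zero_or_pos n with h | h
    · subst h
      simp only [LL, Finset.range_zero, Finset.sum_empty, norm_zero]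
      rw [← hnorm]; exact norm_nonneg _
    · obtain ⟨k, p, hk, hp0, hp, h1⟩ := part_exists e b D n h
      rw [hLb, min_eq_left hn] at h1
      rw [h1]
      exact le_csSup hbd ⟨k, p, hk, hp0, hp, rfl⟩
  · intro B hB
    apply csSup_le
    · exact ⟨_, 1, id, one_pos, rfl, strictMono_id, rfl⟩
    · rintro x ⟨k, p, hk, hp0, hp, rfl⟩
      rw [part_eq e b p hp0 hp k, hLb]
      exact hB _ _ (min_le_right _ _)

/-- unconditionality removes the cut -/
lemma LL_cut (e : ℕ → E) (C : ℝ) (hC : ∀ S F : Finset ℕ, S ⊆ F → ∀ a : ℕ → ℝ,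
    ‖∑ i ∈ S, a i • e i‖ ≤ C * ‖∑ i ∈ F, a i • e i‖) (a : ℕ → ℝ) (D n N) (hn : n ≤ N) :
    ∃ D', ‖LL e a D n‖ ≤ C * ‖LL e a D' N‖ := by
  classical
  let D' : ℕ → Bool := fun i => if i = n then true else D i
  refine ⟨D', ?_⟩
  have h1 : LL e a D n = LL e a D' n :=
    LL_congr _ _ _ _ _ _ (fun i hi => by simp [D', hi.ne]) (fun _ _ => rfl)
  let s : ℕ → ℝ := fun i => ∑ j ∈ Finset.range N with lst D' j = i, a j
  have h2 : LL e a D' N = ∑ i ∈ Finset.range N, s i • e i := by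
    rw [LL, ← Finset.sum_fiberwise_of_maps_to (t := Finset.range N) (g := lst D')]
    · apply Finset.sum_congr rfl
      intro i _
      rw [Finset.sum_smul]
      apply Finset.sum_congr rfl
      intro j hj
      rw [(Finset.mem_filter.1 hj).2]
    · intro j hj
      have := lst_le D' j
      simp at *; omega
  have h3 : LL e a D' n = ∑ i ∈ Finset.range n, s i • e i := by
    rw [LL, ← Finset.sum_fiberwise_of_maps_to (t := Finset.range n) (g := lst D')]
    · apply Finset.sum_congr rfl
      intro i hi
      rw [Finset.sum_smul]
      have hi := Finset.mem_range.1 hi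
      have : (Finset.range N).filter (fun j => lst D' j = i)
          = (Finset.range n).filter (fun j => lst D' j = i) := by
        ext j
        simp only [Finset.mem_filter, Finset.mem_range]
        constructor
        · rintro ⟨h, h'⟩
          refine ⟨?_, h'⟩
          by_contra hj
          have := le_lst D' j n (by omega) (by simp [D'])
          omega
        · rintro ⟨h, h'⟩
          exact ⟨by omega, h'⟩
      rw [this]
      apply Finset.sum_congr rfl
      intro j hj
      rw [(Finset.mem_filter.1 hj).2]
    · intro j hj
      have := lst_le D' j
      simp at *; omega
  rw [h1, h3, h2]
  exact hC _ _ (by intro i; simp; omega) s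

end


lemma lst_const (D : ℕ → Bool) (n j : ℕ) (h : n ≤ j) (h1 : ∀ i, n < i → i ≤ j → D i = false) :
    lst D j = lst D n := by
  induction j, h using Nat.le_induction with
  | base => rfl
  | succ j hnj ih =>
    rw [lst, if_neg (by simp [h1 (j+1) (by omega) le_rfl])]
    exact ih (fun i hi hij => h1 i hi (by omega))

lemma lst_agree (D D' : ℕ → Bool) (m j : ℕ) (h : m ≤ j) (h1 : D m = true) (h2 : D' m = true)
    (h3 : ∀ i, m < i → D' i = D i) :
    lst D j = lst D' j := by
  induction j, h using Nat.le_induction with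
  | base =>
    rw [lst_eq D m m le_rfl (Or.inr h1) (by omega), lst_eq D' m m le_rfl (Or.inr h2) (by omega)]
  | succ j hnj ih => rw [lst, lst, h3 (j+1) (by omega), ih]

section
variable {F : Type*} [NormedAddCommGroup F] [NormedSpace ℝ F]

lemma weak_null (e' : ℕ → F →L[ℝ] ℝ) (hd : Dense (Submodule.span ℝ (Set.range e') : Set (F →L[ℝ] ℝ)))
    (v : ℕ → F) (M : ℝ) (hM : ∀ n, ‖v n‖ ≤ M) (h : ∀ i, Tendsto (fun n => e' i (v n)) atTop (𝓝 0))
    (φ : F →L[ℝ] ℝ) : Tendsto (fun n => φ (v n)) atTop (𝓝 0) := by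
  have hspan : ∀ ψ ∈ Submodule.span ℝ (Set.range e'), Tendsto (fun n => ψ (v n)) atTop (𝓝 0) := by
    intro ψ hψ
    induction hψ using Submodule.span_induction with
    | mem x hx => obtain ⟨i, rfl⟩ := hx; exact h i
    | zero => simp
    | add x y _ _ hx hy => simpa using hx.add hy
    | smul a x _ hx => simpa using hx.const_mul a
  have hM0 : 0 ≤ M := (norm_nonneg _).trans (hM 0)
  rw [Metric.tendsto_atTop]
  intro ε hε
  obtain ⟨ψ, hψ, hdist⟩ := Metric.dense_iff.1 hd φ (ε / (2 * (M + 1))) (by positivity)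
  obtain ⟨N, hN⟩ := (Metric.tendsto_atTop.1 (hspan ψ hdist)) (ε / 2) (by positivity)
  refine ⟨N, fun n hn => ?_⟩
  have h1 := hN n hn
  rw [Real.dist_0_eq_abs] at h1 ⊢
  rw [Metric.mem_ball, dist_comm, dist_eq_norm] at hψ
  have h2 : |(φ - ψ) (v n)| ≤ ε / (2 * (M + 1)) * M :=
    ((φ - ψ).le_opNorm (v n)).trans (mul_le_mul hψ.le (hM n) (norm_nonneg _) (by positivity))
  have h3 : ε / (2 * (M + 1)) * M ≤ ε / 2 := by
    rw [div_mul_eq_mul_div, div_le_div_iff₀ (by positivity) (by positivity)]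
    nlinarith
  have h4 : φ (v n) = (φ - ψ) (v n) + ψ (v n) := by simp
  rw [h4]
  calc |(φ - ψ) (v n) + ψ (v n)| ≤ |(φ - ψ) (v n)| + |ψ (v n)| := abs_add_le _ _
    _ < ε := by linarith

lemma LL_diff (e : ℕ → F) (a : ℕ → ℝ) (D : ℕ → Bool) (n N : ℕ) (ha : ∀ j, j < n → a j = 0)
    (hsum : ∑ j ∈ Finset.range N, a j = 0) :
    ∃ m, m ≤ N ∧ LL e a D N = LL e a (fun i => if i = n then true else D i) N +
      (∑ j ∈ Finset.range m, a j) • (e (lst D n) - e n) ∧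
      ((∑ j ∈ Finset.range m, a j) ≠ 0 → ∃ d, n ≤ d ∧ D d = true) := by
  classical
  set D' : ℕ → Bool := fun i => if i = n then true else D i with hD'
  have main : ∀ m, m ≤ N → (∀ d, n ≤ d → d < m → D d = false) →
      ((n ≤ m ∧ D m = true) ∨ m = N) →
      LL e a D N = LL e a D' N + (∑ j ∈ Finset.range m, a j) • (e (lst D n) - e n) := by
    intro m hm h1 h2
    rw [LL, LL, ← Finset.sum_range_add_sum_Ico _ hm, ← Finset.sum_range_add_sum_Ico (fun j => a j • e (lst D' j)) hm]
    have e1 : ∑ j ∈ Finset.range m, a j • e (lst D j) = ∑ j ∈ Finset.range m, a j • e (lst D' j)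
        + (∑ j ∈ Finset.range m, a j) • (e (lst D n) - e n) := by
      rw [Finset.sum_smul, ← Finset.sum_add_distrib]
      apply Finset.sum_congr rfl
      intro j hj
      have hj := Finset.mem_range.1 hj
      rcases Nat.lt_or_ge j n with h | h
      · simp [ha j h]
      · have l1 : lst D' j = n := by
          apply lst_eq _ _ _ h (by simp [D'])
          intro i hi hij
          simp [D', hi.ne', h1 i hi.le (by omega)]
        have l2 : lst D j = lst D n := by
          exact lst_const D n j h (fun i hi hij => h1 i hi.le (by omega))
        rw [l1, l2, ← smul_add]; congr 1; abel
    have e2 : ∑ j ∈ Finset.Ico m N, a j • e (lst D j) = ∑ j ∈ Finset.Ico m N, a j • e (lst D' j) := by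
      rcases h2 with ⟨hnm, hDm⟩ | h2
      · apply Finset.sum_congr rfl
        intro j hj
        have hj := Finset.mem_Ico.1 hj
        congr 2
        exact lst_agree D D' m j hj.1 hDm (by simp [D', hDm])
          (fun i hi => by simp only [D']; rw [if_neg (by omega)])
      · subst h2; simp
    rw [e1, e2]; abel
  by_cases hex : ∃ d, n ≤ d ∧ D d = true ∧ d < N
  · have hs := Nat.find_spec hex
    refine ⟨Nat.find hex, hs.2.2.le, main _ hs.2.2.le ?_ (Or.inl ⟨hs.1, hs.2.1⟩), fun _ => ⟨_, hs.1, hs.2.1⟩⟩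
    intro d hd hdm
    have := Nat.find_min hex hdm
    by_contra hc
    rw [Bool.not_eq_false] at hc
    exact this ⟨hd, hc, hdm.trans hs.2.2⟩
  · refine ⟨N, le_rfl, main N le_rfl ?_ (Or.inr rfl), fun h => absurd hsum h⟩
    intro d hd hdN
    by_contra hc
    rw [Bool.not_eq_false] at hc
    exact hex ⟨d, hd, hc, hdN⟩

lemma pointwise_null (e : ℕ → F) (he : ∀ i, ‖e i‖ = 1) (e' : ℕ → F →L[ℝ] ℝ)
    (hb : ∀ i j, e' i (e j) = if i = j then 1 else 0)
    (hd : Dense (Submodule.span ℝ (Set.range e') : Set (F →L[ℝ] ℝ)))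
    (a : ℕ → ℕ → ℝ) (N : ℕ → ℕ) (M : ℝ) (ha : ∀ n j, j < n → a n j = 0)
    (hsum : ∀ n, ∑ j ∈ Finset.range (N n), a n j = 0)
    (hM : ∀ n D m, m ≤ N n → ‖LL e (a n) D m‖ ≤ M) (D : ℕ → Bool) (φ : F →L[ℝ] ℝ) :
    Tendsto (fun n => φ (LL e (a n) D (N n))) atTop (𝓝 0) := by
  choose m hm h1 h2 using fun n => LL_diff e (a n) D n (N n) (ha n) (hsum n)
  simp_rw [h1, map_add, map_smul, map_sub, smul_eq_mul]
  have hen : ∀ i, Tendsto (fun n => e' i (e n)) atTop (𝓝 0) := by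
    intro i
    apply tendsto_const_nhds.congr'
    filter_upwards [eventually_gt_atTop i] with n hn
    rw [hb, if_neg hn.ne]
  have hφe : Tendsto (fun n => φ (e n)) atTop (𝓝 0) :=
    weak_null e' hd e 1 (fun n => (he n).le) hen φ
  have hh : ∀ n, |∑ j ∈ Finset.range (m n), a n j| ≤ M := by
    intro n
    have := hM n (fun _ => false) (m n) (hm n)
    have h3 : ∀ j, lst (fun _ => false) j = 0 := fun j => lst_eq _ _ _ (Nat.zero_le _) (Or.inl rfl) (by simp)
    rw [LL] at this
    simp_rw [h3, ← Finset.sum_smul] at this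
    rwa [norm_smul, he, mul_one, Real.norm_eq_abs] at this
  have hbdd : IsBoundedUnder (· ≤ ·) atTop (norm ∘ fun n => ∑ j ∈ Finset.range (m n), a n j) :=
    isBoundedUnder_of ⟨M, hh⟩
  rw [← add_zero (0:ℝ)]
  apply Tendsto.add
  · apply weak_null e' hd _ M (fun n => hM n _ _ le_rfl)
    intro i
    apply tendsto_const_nhds.congr'
    filter_upwards [eventually_gt_atTop i] with n hn
    rw [LL, map_sum, Finset.sum_eq_zero]
    intro j _
    rcases Nat.lt_or_ge j n with h | h
    · simp [ha n j h]
    · have := le_lst (fun i => if i = n then true else D i) j n h (by simp)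
      rw [map_smul, hb, if_neg (by omega), smul_zero]
  · by_cases hinf : ∀ b, ∃ d, b ≤ d ∧ D d = true
    · suffices this : Tendsto (fun n => φ (e (lst D n)) - φ (e n)) atTop (𝓝 0) by
        exact (this.zero_mul_isBoundedUnder_le hbdd).congr (fun n => mul_comm _ _)
      rw [← sub_zero (0:ℝ)]
      apply Tendsto.sub _ hφe
      apply hφe.comp
      apply tendsto_atTop.2
      intro b
      obtain ⟨d, hd, hDd⟩ := hinf b
      filter_upwards [eventually_ge_atTop d] with n hn
      exact hd.trans (le_lst D n d hn hDd)
    · push Not at hinf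
      obtain ⟨b, hb⟩ := hinf
      apply tendsto_const_nhds.congr'
      filter_upwards [eventually_ge_atTop b] with n hn
      have : ∑ j ∈ Finset.range (m n), a n j = 0 := by
        by_contra hne
        obtain ⟨d, hd, hDd⟩ := h2 n hne
        exact hb d (hn.trans hd) hDd
      rw [this, zero_mul]

end


section
variable {F : Type*} [NormedAddCommGroup F] [NormedSpace ℝ F]
  {X : Type*} [NormedAddCommGroup X] [NormedSpace ℝ X]

abbrev KK (F : Type*) [NormedAddCommGroup F] [NormedSpace ℝ F] :=
  (ℕ → Bool) × (WeakDual.toStrongDual ⁻¹' Metric.closedBall (0 : StrongDual ℝ F) 1 : Set (WeakDual ℝ F))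

instance : CompactSpace (KK F) := by
  have : CompactSpace (WeakDual.toStrongDual ⁻¹' Metric.closedBall (0 : StrongDual ℝ F) 1 : Set (WeakDual ℝ F)) :=
    isCompact_iff_compactSpace.1 (WeakDual.isCompact_closedBall 0 1)
  infer_instance

lemma cont_lst (e : ℕ → F) (j : ℕ) :
    Continuous (fun k : KK F => (k.2 : WeakDual ℝ F) (e (lst k.1 j))) := by
  have hev : ∀ v : F, Continuous (fun k : KK F => (k.2 : WeakDual ℝ F) v) := fun v =>
    (WeakDual.eval_continuous v).comp (continuous_subtype_val.comp continuous_snd)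
  induction j with
  | zero => simpa only [lst] using hev (e 0)
  | succ j ih =>
    have h1 : ∀ k : KK F, (k.2 : WeakDual ℝ F) (e (lst k.1 (j+1))) =
        if k.1 (j+1) = true then (k.2 : WeakDual ℝ F) (e (j+1)) else (k.2 : WeakDual ℝ F) (e (lst k.1 j)) := by
      intro k
      rw [lst]; split_ifs <;> rfl
    simp_rw [h1]
    have hc : IsClopen {k : KK F | k.1 (j+1) = true} := by
      have : Continuous (fun k : KK F => k.1 (j+1)) := (continuous_apply (j+1)).comp continuous_fst
      exact (isClopen_discrete {true}).preimage this
    exact Continuous.if (by rw [hc.frontier_eq]; simp) (hev _) ih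

noncomputable def GG (e : ℕ → F) (b : ℕ → ℝ) (N : ℕ) : C(KK F, ℝ) where
  toFun k := ∑ j ∈ Finset.range N, b j * (k.2 : WeakDual ℝ F) (e (lst k.1 j))
  continuous_toFun := continuous_finsetSum _ (fun j _ => (cont_lst e j).const_mul _)

lemma GG_apply (e : ℕ → F) (b : ℕ → ℝ) (N : ℕ) (D : ℕ → Bool) (φ : WeakDual ℝ F) (hφ) :
    GG e b N (D, ⟨φ, hφ⟩) = (WeakDual.toStrongDual φ) (LL e b D N) := by
  simp only [LL, map_sum, map_smul, smul_eq_mul]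
  rfl

lemma key_claim (e : ℕ → F) (he : ∀ i, ‖e i‖ = 1) (C : ℝ) (hC : ∀ S F : Finset ℕ, S ⊆ F → ∀ a : ℕ → ℝ,
    ‖∑ i ∈ S, a i • e i‖ ≤ C * ‖∑ i ∈ F, a i • e i‖) (e' : ℕ → F →L[ℝ] ℝ)
    (hb : ∀ i j, e' i (e j) = if i = j then 1 else 0)
    (hd : Dense (Submodule.span ℝ (Set.range e') : Set (F →L[ℝ] ℝ)))
    (u : ℕ → X)
    (hJ : ∀ (a : ℕ → ℝ) (N : ℕ),
      (∀ D n, n ≤ N → ‖LL e a D n‖ ≤ ‖∑ j ∈ Finset.range N, a j • u j‖) ∧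
      (∀ B, (∀ D n, n ≤ N → ‖LL e a D n‖ ≤ B) → ‖∑ j ∈ Finset.range N, a j • u j‖ ≤ B))
    (f : X →L[ℝ] ℝ) (δ M : ℝ) (hδ : 0 < δ)
    (a : ℕ → ℕ → ℝ) (N : ℕ → ℕ) (ha : ∀ n j, j < n → a n j = 0) (ha' : ∀ n j, N n ≤ j → a n j = 0)
    (hsum : ∀ n, ∑ j ∈ Finset.range (N n), a n j = 0)
    (hM : ∀ n, ‖∑ j ∈ Finset.range (N n), a n j • u j‖ ≤ M)
    (hf : ∀ n, δ ≤ f (∑ j ∈ Finset.range (N n), a n j • u j)) : False := by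
  have hM' : ∀ n D m, m ≤ N n → ‖LL e (a n) D m‖ ≤ M := fun n D m hm =>
    ((hJ (a n) (N n)).1 D m hm).trans (hM n)
  have hC0 : 0 < C := by
    have := hC {0} {0} (by simp) (fun _ => 1)
    simp [he] at this
    linarith
  set ε : ℝ := δ / (2 * C * (‖f‖ + 1)) with hε
  have hε0 : 0 < ε := by positivity
  obtain ⟨h, hh, hlt⟩ := ptak (fun n => GG e (a n) (N n)) M (by
      rintro n ⟨D, φ, hφ⟩
      rw [GG_apply]
      refine ((WeakDual.toStrongDual φ).le_opNorm _).trans ?_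
      have h1 : ‖WeakDual.toStrongDual φ‖ ≤ 1 := by simpa using hφ
      calc _ ≤ 1 * ‖LL e (a n) D (N n)‖ := by gcongr
        _ ≤ M := by rw [one_mul]; exact hM' n D _ le_rfl) (by
      rintro ⟨D, φ, hφ⟩
      simp_rw [GG_apply]
      exact pointwise_null e he e' hb hd a N M ha hsum hM' D _) ε hε0
  have hT : convexHull ℝ (Set.range fun n => GG e (a n) (N n)) ⊆
      {h | ∃ b N', (∀ j, N' ≤ j → b j = 0) ∧ h = GG e b N' ∧
        δ ≤ f (∑ j ∈ Finset.range N', b j • u j)} := by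
    apply convexHull_min
    · rintro _ ⟨n, rfl⟩
      exact ⟨a n, N n, ha' n, rfl, hf n⟩
    · rintro _ ⟨b₁, N₁, hb₁, rfl, hf₁⟩ _ ⟨b₂, N₂, hb₂, rfl, hf₂⟩ s t hs ht hst
      have ext1 : ∀ b N' N'', (∀ j, N' ≤ j → b j = 0) → N' ≤ N'' → GG e b N' = GG e b N'' ∧
          ∑ j ∈ Finset.range N', b j • u j = ∑ j ∈ Finset.range N'', b j • u j := by
        intro b N' N'' hb hN
        constructor
        · ext k
          simp only [GG, ContinuousMap.coe_mk]
          apply Finset.sum_subset (by intro j; simp; omega)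
          intro j _ hj
          rw [hb j (by simpa using hj), zero_mul]
        · apply Finset.sum_subset (by intro j; simp; omega)
          intro j _ hj
          rw [hb j (by simpa using hj), zero_smul]
      have h1 := ext1 b₁ N₁ (max N₁ N₂) hb₁ (le_max_left _ _)
      have h2 := ext1 b₂ N₂ (max N₁ N₂) hb₂ (le_max_right _ _)
      rw [h1.2] at hf₁
      rw [h2.2] at hf₂
      refine ⟨fun j => s * b₁ j + t * b₂ j, max N₁ N₂, ?_, ?_, ?_⟩
      · intro j hj
        simp only [max_le_iff] at hj
        simp [hb₁ j hj.1, hb₂ j hj.2]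
      · rw [h1.1, h2.1]
        ext k
        simp only [GG, ContinuousMap.add_apply, ContinuousMap.smul_apply, ContinuousMap.coe_mk, smul_eq_mul,
          Finset.mul_sum, ← Finset.sum_add_distrib]
        apply Finset.sum_congr rfl
        intro j _; ring
      · simp_rw [add_smul, mul_smul, Finset.sum_add_distrib, ← Finset.smul_sum, map_add, map_smul, smul_eq_mul]
        calc δ = s * δ + t * δ := by rw [← add_mul, hst, one_mul]
          _ ≤ _ := by gcongr
  obtain ⟨b, N', -, rfl, hfb⟩ := hT hh
  have hLL : ∀ D, ‖LL e b D N'‖ ≤ ε := by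
    intro D
    obtain ⟨φ, hφ, hφ'⟩ := exists_dual_vector'' ℝ (LL e b D N')
    have h1 := hlt (D, ⟨StrongDual.toWeakDual φ, by simpa using hφ⟩)
    rw [GG_apply] at h1
    have h2 : φ (LL e b D N') < ε := h1
    rw [hφ'] at h2
    exact h2.le
  have hy : ‖∑ j ∈ Finset.range N', b j • u j‖ ≤ C * ε := by
    apply (hJ b N').2
    intro D n hn
    obtain ⟨D', hD'⟩ := LL_cut e C hC b D n N' hn
    exact hD'.trans (by gcongr; exact hLL D')
  have h1 : f (∑ j ∈ Finset.range N', b j • u j) ≤ ‖f‖ * (C * ε) :=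
    (le_abs_self _).trans ((f.le_opNorm _).trans (by gcongr))
  have h2 : ‖f‖ * (C * ε) < δ := by
    have : ‖f‖ * (C * ε) = δ * (‖f‖ / (2 * (‖f‖ + 1))) := by
      rw [hε]; field_simp
    rw [this]
    have h3 : ‖f‖ / (2 * (‖f‖ + 1)) < 1 := by
      rw [div_lt_one (by positivity)]
      nlinarith [norm_nonneg f]
    nlinarith
  linarith

end


section
variable {X : Type*} [NormedAddCommGroup X] [NormedSpace ℝ X]

noncomputable def PP (u : ℕ → X) (u' : ℕ → X →L[ℝ] ℝ) (n : ℕ) : X →L[ℝ] X :=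
  ∑ i ∈ Finset.range n, (u' i).smulRight (u i)

noncomputable def RR (u : ℕ → X) (u' : ℕ → X →L[ℝ] ℝ) (S : X →L[ℝ] ℝ) (n : ℕ) : X →L[ℝ] X :=
  (ContinuousLinearMap.id ℝ X - PP u u' n) -
    (S.comp (ContinuousLinearMap.id ℝ X - PP u u' n)).smulRight (u n)

structure Core (u : ℕ → X) (u' : ℕ → X →L[ℝ] ℝ) (S : X →L[ℝ] ℝ) : Prop where
  bi : ∀ i j, u' i (u j) = if i = j then 1 else 0
  dense : Dense (Submodule.span ℝ (Set.range u) : Set X)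
  mono : ∀ (a : ℕ → ℝ) (n N : ℕ), n ≤ N →
    ‖∑ j ∈ Finset.range n, a j • u j‖ ≤ ‖∑ j ∈ Finset.range N, a j • u j‖
  le_one : ∀ n, ‖u n‖ ≤ 1
  hS : ∀ n, S (u n) = 1

variable {u : ℕ → X} {u' : ℕ → X →L[ℝ] ℝ} {S : X →L[ℝ] ℝ}

lemma PP_apply (n : ℕ) (x : X) : PP u u' n x = ∑ i ∈ Finset.range n, u' i x • u i := by
  simp [PP]

lemma RR_apply (n : ℕ) (x : X) :
    RR u u' S n x = x - PP u u' n x - (S x - S (PP u u' n x)) • u n := by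
  simp [RR]

namespace Core

lemma coord_sum (h : Core u u' S) (c : ℕ → ℝ) (i n : ℕ) :
    u' i (∑ j ∈ Finset.range n, c j • u j) = if i < n then c i else 0 := by
  simp [map_sum, h.bi]

lemma coord_PP (h : Core u u' S) (i n : ℕ) (x : X) : u' i (PP u u' n x) = if i < n then u' i x else 0 := by
  rw [PP_apply, h.coord_sum]

lemma PP_span (h : Core u u' S) (x : X) (hx : x ∈ Submodule.span ℝ (Set.range u)) :
    ∃ N0, ∀ N, N0 ≤ N → PP u u' N x = x := by
  induction hx using Submodule.span_induction with
  | mem x hx =>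
    obtain ⟨i, rfl⟩ := hx
    refine ⟨i+1, fun N hN => ?_⟩
    rw [PP_apply]
    simp only [h.bi, ite_smul, one_smul, zero_smul]
    rw [Finset.sum_ite_eq' , if_pos (by simp; omega)]
  | zero => exact ⟨0, fun N _ => by simp⟩
  | add x y _ _ hx hy =>
    obtain ⟨a, ha⟩ := hx
    obtain ⟨b, hb⟩ := hy
    exact ⟨max a b, fun N hN => by
      rw [map_add, ha N ((le_max_left _ _).trans hN), hb N ((le_max_right _ _).trans hN)]⟩
  | smul c x _ hx =>
    obtain ⟨a, ha⟩ := hx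
    exact ⟨a, fun N hN => by rw [map_smul, ha N hN]⟩

lemma PP_le (h : Core u u' S) (n : ℕ) (x : X) : ‖PP u u' n x‖ ≤ ‖x‖ := by
  have hcl : IsClosed {x : X | ‖PP u u' n x‖ ≤ ‖x‖} :=
    isClosed_le (PP u u' n).continuous.norm continuous_norm
  have hsub : (Submodule.span ℝ (Set.range u) : Set X) ⊆ {x : X | ‖PP u u' n x‖ ≤ ‖x‖} := by
    intro x hx
    obtain ⟨N0, hN⟩ := h.PP_span x hx
    have h1 := h.mono (fun j => u' j x) n (max n N0) (le_max_left _ _)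
    rw [← PP_apply, ← PP_apply, hN _ (le_max_right _ _)] at h1
    exact h1
  exact closure_minimal hsub hcl (h.dense x)

lemma PP_tendsto (h : Core u u' S) (x : X) : Tendsto (fun n => PP u u' n x) atTop (𝓝 x) := by
  rw [Metric.tendsto_atTop]
  intro ε hε
  obtain ⟨y, hy, hys⟩ := Metric.dense_iff.1 h.dense x (ε/2) (by positivity)
  obtain ⟨N, hN⟩ := h.PP_span y hys
  refine ⟨N, fun n hn => ?_⟩
  rw [Metric.mem_ball, dist_comm, dist_eq_norm] at hy
  rw [dist_eq_norm]
  have : PP u u' n x - x = PP u u' n (x - y) - (x - y) := by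
    rw [map_sub, hN n hn]; abel
  rw [this]
  have := norm_sub_le (PP u u' n (x - y)) (x - y)
  have := h.PP_le n (x - y)
  linarith

lemma RR_le (h : Core u u' S) (n : ℕ) (x : X) : ‖RR u u' S n x‖ ≤ (2 + 2 * ‖S‖) * ‖x‖ := by
  rw [RR_apply]
  have h1 := norm_sub_le (x - PP u u' n x) ((S x - S (PP u u' n x)) • u n)
  have h2 := norm_sub_le x (PP u u' n x)
  have h3 := h.PP_le n x
  have h4 : ‖(S x - S (PP u u' n x)) • u n‖ ≤ ‖S‖ * (2 * ‖x‖) := by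
    rw [norm_smul, ← map_sub]
    calc _ ≤ ‖S (x - PP u u' n x)‖ * 1 := by gcongr; exact h.le_one n
      _ ≤ ‖S‖ * ‖x - PP u u' n x‖ := by rw [mul_one]; exact S.le_opNorm _
      _ ≤ ‖S‖ * (2 * ‖x‖) := by gcongr; linarith
  nlinarith

lemma S_RR (h : Core u u' S) (n : ℕ) (x : X) : S (RR u u' S n x) = 0 := by
  rw [RR_apply]; simp [h.hS]

/-- coordinates of `R_n P_N x` -/
lemma RRPP_eq (h : Core u u' S) (n N : ℕ) (hn : n < N) (x : X) :
    RR u u' S n (PP u u' N x) = ∑ j ∈ Finset.range N, u' j (RR u u' S n (PP u u' N x)) • u j := by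
  have h2 : ∀ m, m ≤ N → PP u u' N (PP u u' m x) = PP u u' m x := by
    intro m hm
    rw [PP_apply N]
    simp_rw [h.coord_PP, ite_smul, zero_smul]
    rw [← Finset.sum_filter, PP_apply]
    congr 1
    ext j; simp; omega
  have h2' : PP u u' n (PP u u' N x) = PP u u' n x := by
    rw [PP_apply n, PP_apply n]
    apply Finset.sum_congr rfl
    intro j hj
    rw [h.coord_PP, if_pos (by simp at hj; omega)]
  have h3 : PP u u' N (u n) = u n := by
    rw [PP_apply]
    simp only [h.bi, ite_smul, one_smul, zero_smul]
    rw [Finset.sum_ite_eq' , if_pos (by simp; omega)]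
  rw [← PP_apply, RR_apply, h2', map_sub, map_sub, map_smul, h2 N le_rfl, h2 n hn.le, h3]

lemma RR_coord_lt (h : Core u u' S) (n : ℕ) (x : X) (j : ℕ) (hj : j < n) : u' j (RR u u' S n x) = 0 := by
  rw [RR_apply]
  simp [h.coord_PP, h.bi, hj, hj.ne]

lemma RRPP_coord_ge (h : Core u u' S) (n N : ℕ) (hn : n < N) (x : X) (j : ℕ) (hj : N ≤ j) :
    u' j (RR u u' S n (PP u u' N x)) = 0 := by
  rw [h.RRPP_eq n N hn x, h.coord_sum, if_neg (by omega)]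

lemma _root_.RR_decomp (f : X →L[ℝ] ℝ) (n : ℕ) (x : X) :
    f x = f (RR u u' S n x) + f (PP u u' n x) + f (u n) * (S x - S (PP u u' n x)) := by
  rw [RR_apply]; simp; ring

/-- the dual statement -/
lemma RR_null (h : Core u u' S) {F : Type*} [NormedAddCommGroup F] [NormedSpace ℝ F] (e : ℕ → F) (he : ∀ i, ‖e i‖ = 1)
    (C : ℝ) (hC : ∀ S F : Finset ℕ, S ⊆ F → ∀ a : ℕ → ℝ,
    ‖∑ i ∈ S, a i • e i‖ ≤ C * ‖∑ i ∈ F, a i • e i‖) (e' : ℕ → F →L[ℝ] ℝ)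
    (hb : ∀ i j, e' i (e j) = if i = j then 1 else 0)
    (hd : Dense (Submodule.span ℝ (Set.range e') : Set (F →L[ℝ] ℝ)))
    (hJ : ∀ (a : ℕ → ℝ) (N : ℕ),
      (∀ D n, n ≤ N → ‖LL e a D n‖ ≤ ‖∑ j ∈ Finset.range N, a j • u j‖) ∧
      (∀ B, (∀ D n, n ≤ N → ‖LL e a D n‖ ≤ B) → ‖∑ j ∈ Finset.range N, a j • u j‖ ≤ B))
    (f : X →L[ℝ] ℝ) (δ : ℝ) (hδ : 0 < δ) :
    ∀ᶠ n in atTop, ∀ x, |f (RR u u' S n x)| ≤ δ * ‖x‖ := by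
  by_contra hcon
  rw [Filter.not_eventually, frequently_atTop] at hcon
  have hex : ∀ n, ∃ m, n ≤ m ∧ ∃ N, m < N ∧ ∃ x, ‖x‖ ≤ 1 ∧ δ ≤ f (RR u u' S m (PP u u' N x)) := by
    intro n
    obtain ⟨m, hm, hx⟩ := hcon n
    push Not at hx
    obtain ⟨x, hx⟩ := hx
    have hx0 : 0 < ‖x‖ := by
      rcases eq_or_ne x 0 with rfl | h0
      · simp at hx
      · exact norm_pos_iff.2 h0
    obtain ⟨y, hy, hfy⟩ : ∃ y, ‖y‖ ≤ 1 ∧ δ < f (RR u u' S m y) := by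
      have hlt : δ < |f (RR u u' S m x)| / ‖x‖ := by rw [lt_div_iff₀ hx0]; exact hx
      rcases abs_cases (f (RR u u' S m x)) with ⟨h1, _⟩ | ⟨h1, _⟩
      · refine ⟨‖x‖⁻¹ • x, ?_, ?_⟩
        · rw [norm_smul, norm_inv, norm_norm, inv_mul_cancel₀ hx0.ne']
        · rw [map_smul, map_smul, smul_eq_mul, ← h1, mul_comm, ← div_eq_mul_inv]; exact hlt
      · refine ⟨(-‖x‖⁻¹) • x, ?_, ?_⟩
        · rw [norm_smul, norm_neg, norm_inv, norm_norm, inv_mul_cancel₀ hx0.ne']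
        · rw [map_smul, map_smul, smul_eq_mul, neg_mul, ← mul_neg, ← h1, mul_comm, ← div_eq_mul_inv]
          exact hlt
    have ht : Tendsto (fun N => f (RR u u' S m (PP u u' N y))) atTop (𝓝 (f (RR u u' S m y))) :=
      ((f.continuous.comp (RR u u' S m).continuous).tendsto _).comp (h.PP_tendsto y)
    obtain ⟨N, hN1, hN2⟩ := ((ht.eventually (lt_mem_nhds hfy)).and (eventually_gt_atTop m)).exists
    exact ⟨m, hm, N, hN2, y, hy, hN1.le⟩
  choose m hm N hN x hx hfx using hex
  refine key_claim e he C hC e' hb hd u hJ f δ (2 + 2 * ‖S‖) hδ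
    (fun n j => u' j (RR u u' S (m n) (PP u u' (N n) (x n)))) N ?_ ?_ ?_ ?_ ?_
  · intro n j hj
    exact h.RR_coord_lt _ _ _ (lt_of_lt_of_le hj (hm n))
  · intro n j hj
    exact h.RRPP_coord_ge _ _ (hN n) _ _ hj
  · intro n
    have h1 := congrArg S (h.RRPP_eq (m n) (N n) (hN n) (x n))
    rw [h.S_RR, map_sum] at h1
    simp only [map_smul, h.hS, smul_eq_mul, mul_one] at h1
    exact h1.symm
  · intro n
    rw [← h.RRPP_eq _ _ (hN n)]
    calc _ ≤ (2 + 2 * ‖S‖) * ‖PP u u' (N n) (x n)‖ := h.RR_le _ _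
      _ ≤ (2 + 2 * ‖S‖) * 1 := by gcongr; exact (h.PP_le _ _).trans (hx n)
      _ = _ := mul_one _
  · intro n
    rw [← h.RRPP_eq _ _ (hN n)]
    exact hfx n

end Core
end


lemma glue (q : ℕ → ℕ) (hq : StrictMono q) (b : ℕ → ℕ → ℝ) :
    ∃ a : ℕ → ℝ, ∀ n, ∀ i ∈ Finset.Ico (q n) (q (n+1)), a i = b n i := by
  classical
  refine ⟨fun i => if h : ∃ n, i ∈ Finset.Ico (q n) (q (n+1)) then b h.choose i else 0, ?_⟩
  intro n i hi
  have hex : ∃ n, i ∈ Finset.Ico (q n) (q (n+1)) := ⟨n, hi⟩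
  simp only [dif_pos hex]
  have h1 := hex.choose_spec
  generalize hex.choose = m at h1
  rw [Finset.mem_Ico] at hi h1
  have a1 := hq.lt_iff_lt.1 (lt_of_le_of_lt hi.1 h1.2)
  have a2 := hq.lt_iff_lt.1 (lt_of_le_of_lt h1.1 hi.2)
  have : m = n := by omega
  rw [this]

section
variable {X : Type*} [NormedAddCommGroup X] [NormedSpace ℝ X]

lemma extract {Y Z : Type*} [NormedAddCommGroup Y] [NormedSpace ℝ Y] [NormedAddCommGroup Z] [NormedSpace ℝ Z]
    [CompleteSpace Z] (T : Y →L[ℝ] Z) (hT : ¬ IsCompactOp T) :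
    ∃ δ : ℝ, 0 < δ ∧ ∃ y : ℕ → Y, (∀ n, ‖y n‖ ≤ 1) ∧ ∀ m n, m < n → δ ≤ ‖T (y n) - T (y m)‖ := by
  have h1 : ¬ TotallyBounded (T '' Metric.closedBall 0 1) := fun h =>
    hT (h.closure.isCompact_of_isClosed isClosed_closure)
  rw [Metric.totallyBounded_iff] at h1
  push Not at h1
  obtain ⟨δ, hδ, h2⟩ := h1
  refine ⟨δ, hδ, ?_⟩
  apply exists_seq_of_forall_finset_exists (fun y : Y => ‖y‖ ≤ 1) (fun x y => δ ≤ ‖T y - T x‖)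
  intro s _
  have h3 := h2 (T '' (s : Set Y)) (s.finite_toSet.image _)
  rw [Set.not_subset] at h3
  obtain ⟨_, ⟨y, hy, rfl⟩, hyn⟩ := h3
  refine ⟨y, by simpa using hy, fun x hx => ?_⟩
  by_contra hlt
  push Not at hlt
  apply hyn
  rw [Set.mem_iUnion₂]
  exact ⟨T x, ⟨x, hx, rfl⟩, by rw [Metric.mem_ball, dist_eq_norm]; exact hlt⟩

lemma subseq_conv {Y : Type*} [NormedAddCommGroup Y] [NormedSpace ℝ Y] (g : ℕ → Y →L[ℝ] ℝ)
    (y : ℕ → Y) (hy : ∀ n, ‖y n‖ ≤ 1) :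
    ∃ φ : ℕ → ℕ, StrictMono φ ∧ ∀ i, ∃ l, Tendsto (fun n => g i (y (φ n))) atTop (𝓝 l) := by
  have hc : IsCompact (Set.univ.pi fun i => Set.Icc (-‖g i‖) ‖g i‖ : Set (ℕ → ℝ)) :=
    isCompact_univ_pi fun i => isCompact_Icc
  obtain ⟨l, -, φ, hφ, hl⟩ := hc.tendsto_subseq (x := fun n i => g i (y n)) (by
    intro n i _
    rw [Set.mem_Icc, ← abs_le]
    calc |g i (y n)| ≤ ‖g i‖ * ‖y n‖ := (g i).le_opNorm _
      _ ≤ ‖g i‖ * 1 := by gcongr; exact hy n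
      _ = _ := mul_one _)
  exact ⟨φ, hφ, fun i => ⟨l i, (tendsto_pi_nhds.1 hl) i⟩⟩

variable {u : ℕ → X} {u' : ℕ → X →L[ℝ] ℝ} {S : X →L[ℝ] ℝ}
namespace Core

lemma _root_.PP_null (z : ℕ → X) (hz : ∀ i, Tendsto (fun k => u' i (z k)) atTop (𝓝 0)) (n : ℕ) :
    Tendsto (fun k => PP u u' n (z k)) atTop (𝓝 0) := by
  simp_rw [PP_apply]
  rw [← Finset.sum_const_zero (s := Finset.range n)]
  apply tendsto_finsetSum
  intro i _
  simpa using (hz i).smul_const (u i)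

lemma wnull (hR : ∀ (f : X →L[ℝ] ℝ) (δ : ℝ), 0 < δ →
      ∀ᶠ n in atTop, ∀ x, |f (RR u u' S n x)| ≤ δ * ‖x‖)
    (z : ℕ → X) (B : ℝ) (hB : ∀ k, ‖z k‖ ≤ B)
    (hz : ∀ i, Tendsto (fun k => u' i (z k)) atTop (𝓝 0))
    (hzS : Tendsto (fun k => S (z k)) atTop (𝓝 0)) (f : X →L[ℝ] ℝ) :
    Tendsto (fun k => f (z k)) atTop (𝓝 0) := by
  have hB0 : 0 ≤ B := (norm_nonneg _).trans (hB 0)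
  rw [Metric.tendsto_atTop]
  intro ε hε
  obtain ⟨n, hn⟩ := (hR f (ε / (2 * (B + 1))) (by positivity)).exists
  have hP := PP_null (u := u) z hz n
  have h1 : Tendsto (fun k => f (PP u u' n (z k)) + f (u n) * (S (z k) - S (PP u u' n (z k)))) atTop (𝓝 0) := by
    have a1 : Tendsto (fun k => f (PP u u' n (z k))) atTop (𝓝 0) := by
      simpa [Function.comp_def] using (f.continuous.tendsto 0).comp hP
    have a2 : Tendsto (fun k => S (PP u u' n (z k))) atTop (𝓝 0) := by
      simpa [Function.comp_def] using (S.continuous.tendsto 0).comp hP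
    simpa using a1.add ((hzS.sub a2).const_mul (f (u n)))
  obtain ⟨N, hN⟩ := Metric.tendsto_atTop.1 h1 (ε / 2) (by positivity)
  refine ⟨N, fun k hk => ?_⟩
  have h2 := hN k hk
  rw [Real.dist_0_eq_abs] at h2 ⊢
  rw [RR_decomp (u := u) (u' := u') (S := S) f n (z k), add_assoc]
  have h3 := hn (z k)
  have h4 : ε / (2 * (B + 1)) * ‖z k‖ ≤ ε / 2 := by
    calc _ ≤ ε / (2 * (B + 1)) * B := by gcongr; exact hB k
      _ ≤ ε / 2 := by
        rw [div_mul_eq_mul_div, div_le_div_iff₀ (by positivity) (by positivity)]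
        nlinarith
  exact lt_of_le_of_lt (abs_add_le _ _) (by linarith)

lemma lim_exists (h : Core u u' S) (hR : ∀ (f : X →L[ℝ] ℝ) (δ : ℝ), 0 < δ →
      ∀ᶠ n in atTop, ∀ x, |f (RR u u' S n x)| ≤ δ * ‖x‖) (g : X →L[ℝ] ℝ) :
    ∃ c, Tendsto (fun n => g (u n)) atTop (𝓝 c) := by
  apply cauchySeq_tendsto_of_complete
  rw [Metric.cauchySeq_iff']
  intro ε hε
  obtain ⟨n, hn⟩ := (hR g (ε/2) (by positivity)).exists
  refine ⟨n, fun m hm => ?_⟩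
  rcases hm.eq_or_lt with rfl | hlt
  · simpa using hε
  · have h1 := hn (u m)
    have h2 : PP u u' n (u m) = 0 := by
      rw [PP_apply]
      apply Finset.sum_eq_zero
      intro i hi
      rw [h.bi, if_neg (by simp at hi; omega), zero_smul]
    rw [RR_apply, h2, h.hS] at h1
    simp only [sub_zero, map_zero, one_smul, map_sub] at h1
    rw [Real.dist_eq]
    have := h.le_one m
    have : ε / 2 * ‖u m‖ ≤ ε / 2 * 1 := by gcongr
    linarith

lemma tail (h : Core u u' S) (hR : ∀ (f : X →L[ℝ] ℝ) (δ : ℝ), 0 < δ →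
      ∀ᶠ n in atTop, ∀ x, |f (RR u u' S n x)| ≤ δ * ‖x‖) (g : X →L[ℝ] ℝ) (c : ℝ)
    (hc : Tendsto (fun n => g (u n)) atTop (𝓝 c)) (ε : ℝ) (hε : 0 < ε) :
    ∀ᶠ N in atTop, ∀ x, |g x - g (PP u u' N x)| ≤ (ε + 2 * ‖S‖ * (|c| + ε)) * ‖x‖ := by
  have h1 : ∀ᶠ n in atTop, |g (u n)| < |c| + ε :=
    (hc.abs).eventually (gt_mem_nhds (by linarith))
  filter_upwards [h1, hR g ε hε] with N hN hN' x
  have h2 : g x - g (PP u u' N x) = g (RR u u' S N x) + g (u N) * S (x - PP u u' N x) := by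
    rw [RR_decomp (u := u) (u' := u') (S := S) g N x, map_sub]; ring
  rw [h2]
  have h3 : |S (x - PP u u' N x)| ≤ ‖S‖ * (2 * ‖x‖) := by
    refine (S.le_opNorm _).trans ?_
    gcongr
    have := norm_sub_le x (PP u u' N x)
    have := h.PP_le N x
    linarith
  calc _ ≤ |g (RR u u' S N x)| + |g (u N) * S (x - PP u u' N x)| := abs_add_le _ _
    _ ≤ ε * ‖x‖ + (|c| + ε) * (‖S‖ * (2 * ‖x‖)) := by
      rw [abs_mul]
      gcongr
      exact hN' x
    _ = _ := by ring

lemma step (h : Core u u' S) [CompleteSpace X] (hR : ∀ (f : X →L[ℝ] ℝ) (δ : ℝ), 0 < δ →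
      ∀ᶠ n in atTop, ∀ x, |f (RR u u' S n x)| ≤ δ * ‖x‖)
    (Y : Submodule ℝ X) (hY : IsClosed (Y : Set X)) (T : Y →L[ℝ] (X →L[ℝ] ℝ))
    (z : ℕ → Y) (B : ℝ) (hB : ∀ k, ‖z k‖ ≤ B)
    (hz : ∀ i, Tendsto (fun k => u' i (z k)) atTop (𝓝 0))
    (hzS : Tendsto (fun k => S (z k)) atTop (𝓝 0)) (q : ℕ) (ε : ℝ) (hε : 0 < ε) :
    ∃ k N, q < N ∧ ‖RR u u' S q (PP u u' N (z k)) - z k‖ ≤ ε ∧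
      ∀ x, |T (z k) x - T (z k) (PP u u' N x - PP u u' q x)| ≤ ε * ‖x‖ := by
  have : CompleteSpace Y := hY.completeSpace_coe
  have hw : ∀ g : Y →L[ℝ] ℝ, Tendsto (fun k => g (z k)) atTop (𝓝 0) := by
    intro g
    obtain ⟨G, hG, -⟩ := exists_extension_norm_eq Y g
    simp_rw [← hG]
    exact wnull hR (fun k => (z k : X)) B hB hz hzS G
  choose c hc using fun y : Y => h.lim_exists hR (T y)
  have hcz : Tendsto (fun k => c (z k)) atTop (𝓝 0) := by
    let cT : Y →L[ℝ] ℝ := continuousLinearMapOfTendsto (l := atTop)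
      (fun n : ℕ => (ContinuousLinearMap.apply ℝ ℝ (u n)).comp T) (f := c)
      (tendsto_pi_nhds.2 hc)
    exact hw cT
  have hTu : ∀ i, Tendsto (fun k => T (z k) (u i)) atTop (𝓝 0) := fun i =>
    hw ((ContinuousLinearMap.apply ℝ ℝ (u i)).comp T)
  have hP := PP_null (u := u) (fun k => (z k : X)) hz q
  have hRz : Tendsto (fun k => RR u u' S q (z k) - z k) atTop (𝓝 0) := by
    have e1 : ∀ k, RR u u' S q (z k) - z k =
        -PP u u' q (z k) - (S (z k) - S (PP u u' q (z k))) • u q := by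
      intro k; rw [RR_apply]; abel
    simp_rw [e1]
    have a2 : Tendsto (fun k => S (PP u u' q (z k))) atTop (𝓝 0) := by
      simpa [Function.comp_def] using (S.continuous.tendsto 0).comp hP
    simpa using hP.neg.sub ((hzS.sub a2).smul_const (u q))
  have hsum : Tendsto (fun k => ∑ i ∈ Finset.range q, ‖u' i‖ * |T (z k) (u i)|) atTop (𝓝 0) := by
    rw [← Finset.sum_const_zero (s := Finset.range q)]
    apply tendsto_finsetSum
    intro i _
    simpa using ((hTu i).abs).const_mul ‖u' i‖
  set η : ℝ := ε / (2 * (1 + 4 * ‖S‖)) with hη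
  have hη0 : 0 < η := by positivity
  have hηε : η + 2 * ‖S‖ * (η + η) = ε / 2 := by
    rw [hη]; field_simp; ring
  have ev1 : ∀ᶠ k in atTop, ‖RR u u' S q (z k) - z k‖ < ε := by
    have := hRz.norm
    rw [norm_zero] at this
    exact this.eventually (gt_mem_nhds hε)
  have ev2 : ∀ᶠ k in atTop, |c (z k)| < η := by
    have := hcz.abs
    rw [abs_zero] at this
    exact this.eventually (gt_mem_nhds hη0)
  have ev3 := hsum.eventually (gt_mem_nhds (half_pos hε))
  obtain ⟨k, h1, h2, h3⟩ := (ev1.and (ev2.and ev3)).exists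
  have ev4 : ∀ᶠ N in atTop, ‖RR u u' S q (PP u u' N (z k)) - z k‖ < ε := by
    have a := (((RR u u' S q).continuous.tendsto _).comp (h.PP_tendsto (z k : X))).sub_const (z k : X)
    exact a.norm.eventually (gt_mem_nhds h1)
  obtain ⟨N, h4, h5, h6⟩ := (ev4.and ((h.tail hR (T (z k)) _ (hc (z k)) η hη0).and
    (eventually_gt_atTop q))).exists
  refine ⟨k, N, h6, h4.le, fun x => ?_⟩
  have h7 := h5 x
  have h8 : |T (z k) (PP u u' q x)| ≤ ε / 2 * ‖x‖ := by
    rw [PP_apply, map_sum]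
    calc _ ≤ ∑ i ∈ Finset.range q, |T (z k) (u' i x • u i)| := Finset.abs_sum_le_sum_abs _ _
      _ ≤ ∑ i ∈ Finset.range q, ‖u' i‖ * |T (z k) (u i)| * ‖x‖ := by
        apply Finset.sum_le_sum
        intro i _
        rw [map_smul, smul_eq_mul, abs_mul]
        have := (u' i).le_opNorm x
        rw [Real.norm_eq_abs] at this
        nlinarith [abs_nonneg (T (z k) (u i))]
      _ = (∑ i ∈ Finset.range q, ‖u' i‖ * |T (z k) (u i)|) * ‖x‖ := by rw [Finset.sum_mul]
      _ ≤ _ := by gcongr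
  have h9 : (η + 2 * ‖S‖ * (|c (z k)| + η)) * ‖x‖ ≤ ε / 2 * ‖x‖ := by
    rw [← hηε]; gcongr
  have h10 : T (z k) x - T (z k) (PP u u' N x - PP u u' q x) =
      (T (z k) x - T (z k) (PP u u' N x)) + T (z k) (PP u u' q x) := by
    rw [map_sub]; ring
  rw [h10]
  refine (abs_add_le _ _).trans ?_
  linarith

end Core
end


section
variable {X : Type*} [NormedAddCommGroup X] [NormedSpace ℝ X]
variable {u : ℕ → X} {u' : ℕ → X →L[ℝ] ℝ} {S : X →L[ℝ] ℝ}

lemma sum_eps (s : Finset ℕ) (ε K : ℝ) (hε : 0 ≤ ε) (hK : 0 ≤ K) (a : ℕ → ℝ) (ha : ∀ i ∈ s, |a i| ≤ K) :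
    ∑ i ∈ s, |a i| * (ε * (1/2)^i) ≤ 2 * ε * K := by
  calc _ ≤ ∑ i ∈ s, K * (ε * (1/2)^i) := by
        apply Finset.sum_le_sum
        intro i hi
        exact mul_le_mul_of_nonneg_right (ha i hi) (by positivity)
    _ = K * ε * ∑ i ∈ s, (1/2 : ℝ)^i := by
        rw [Finset.mul_sum]; apply Finset.sum_congr rfl; intros; ring
    _ ≤ K * ε * 2 := by
        gcongr
        exact (summable_geometric_two.sum_le_tsum _ (fun i _ => by positivity)).trans tsum_geometric_two.le
    _ = _ := by ring

theorem Core.main (h : Core u u' S) [CompleteSpace X] (hR : ∀ (f : X →L[ℝ] ℝ) (δ : ℝ), 0 < δ →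
      ∀ᶠ n in atTop, ∀ x, |f (RR u u' S n x)| ≤ δ * ‖x‖)
    (Y : Submodule ℝ X) (hY : IsClosed (Y : Set X)) (T : Y →L[ℝ] (X →L[ℝ] ℝ)) (hT : ¬ IsCompactOp T) :
    ∃ (x : ℕ → X) (x' : ℕ → X →L[ℝ] ℝ),
      IsBlockBasis u x ∧ IsBlockBasis u' x' ∧ SemiNormalized x ∧ SemiNormalized x' ∧
      Dominates x x' ∧ ∀ i, S (x i) = 0 := by
  obtain ⟨δ, hδ, y, hy, hTy⟩ := extract T hT
  obtain ⟨φ, hφ, hconv⟩ := subseq_conv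
    (fun i => Nat.casesOn i (S.comp Y.subtypeL) (fun i => (u' i).comp Y.subtypeL) : ℕ → Y →L[ℝ] ℝ) y hy
  let z : ℕ → Y := fun k => y (φ (k+1)) - y (φ k)
  have hdiff : ∀ g : Y →L[ℝ] ℝ, (∃ l, Tendsto (fun n => g (y (φ n))) atTop (𝓝 l)) →
      Tendsto (fun k => g (z k)) atTop (𝓝 0) := by
    rintro g ⟨l, hl⟩
    have := (hl.comp (tendsto_add_atTop_nat 1)).sub hl
    simpa [Function.comp_def, z] using this
  have hzS : Tendsto (fun k => S (z k)) atTop (𝓝 0) := hdiff (S.comp Y.subtypeL) (hconv 0)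
  have hz : ∀ i, Tendsto (fun k => u' i (z k)) atTop (𝓝 0) := fun i =>
    hdiff ((u' i).comp Y.subtypeL) (hconv (i+1))
  have hB : ∀ k, ‖z k‖ ≤ 2 := by
    intro k
    have := norm_sub_le (y (φ (k+1))) (y (φ k))
    have := hy (φ (k+1))
    have := hy (φ k)
    simp only [z]; linarith
  have hTz : ∀ k, δ ≤ ‖T (z k)‖ := by
    intro k
    have := hTy (φ k) (φ (k+1)) (hφ (Nat.lt_succ_self k))
    simpa [z] using this
  set d : ℝ := δ / (‖T‖ + 1) with hd
  have hd0 : 0 < d := by positivity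
  have hzd : ∀ k, d ≤ ‖z k‖ := by
    intro k
    rw [hd, div_le_iff₀ (by positivity)]
    have := (hTz k).trans (T.le_opNorm (z k))
    nlinarith [norm_nonneg (z k)]
  set ε₀ : ℝ := min (d/2) (δ/2) with hε₀
  have hε₀p : 0 < ε₀ := by positivity
  have hε₀d : ε₀ ≤ d/2 := min_le_left _ _
  have hε₀δ : ε₀ ≤ δ/2 := min_le_right _ _
  choose kf Nf hqN hx hx' using fun (q j : ℕ) =>
    h.step hR Y hY T z 2 hB hz hzS q (ε₀ * (1/2)^j) (by positivity)
  let q : ℕ → ℕ := fun n => Nat.rec 0 (fun j qj => Nf qj j) n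
  have hq1 : ∀ j, q (j+1) = Nf (q j) j := fun j => rfl
  have hq : StrictMono q := strictMono_nat_of_lt_succ (fun j => by rw [hq1]; exact hqN _ _)
  let w : ℕ → Y := fun j => z (kf (q j) j)
  let x : ℕ → X := fun j => RR u u' S (q j) (PP u u' (q (j+1)) (w j))
  let x' : ℕ → X →L[ℝ] ℝ := fun j => ∑ i ∈ Finset.Ico (q j) (q (j+1)), (T (w j) (u i)) • u' i
  have hεj : ∀ j, ε₀ * (1/2 : ℝ)^j ≤ ε₀ := fun j => by
    have : (1/2 : ℝ)^j ≤ 1 := pow_le_one₀ (by norm_num) (by norm_num)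
    nlinarith
  have hxw : ∀ j, ‖x j - w j‖ ≤ ε₀ * (1/2)^j := fun j => hx (q j) j
  have hx'app : ∀ j v, x' j v = T (w j) (PP u u' (q (j+1)) v - PP u u' (q j) v) := by
    intro j v
    rw [PP_apply, PP_apply, ← Finset.sum_Ico_eq_sub _ (hq (Nat.lt_succ_self j)).le, map_sum]
    simp only [x', sum_apply, map_smul, smul_apply, smul_eq_mul]
    apply Finset.sum_congr rfl
    intros; ring
  have hx'w : ∀ j, ‖x' j - T (w j)‖ ≤ ε₀ * (1/2)^j := by
    intro j
    apply ContinuousLinearMap.opNorm_le_bound _ (by positivity)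
    intro v
    rw [sub_apply, hx'app, Real.norm_eq_abs, abs_sub_comm]
    exact hx' (q j) j v
  have hwd : ∀ j, d ≤ ‖(w j : X)‖ := fun j => hzd _
  have hw2 : ∀ j, ‖(w j : X)‖ ≤ 2 := fun j => hB _
  have hxl : ∀ j, d/2 ≤ ‖x j‖ := by
    intro j
    have h1 := norm_sub_norm_le (w j : X) (x j)
    rw [norm_sub_rev] at h1
    linarith [hxw j, hεj j, hwd j]
  have hxu : ∀ j, ‖x j‖ ≤ 2 + ε₀ := by
    intro j
    have h1 := norm_sub_norm_le (x j) (w j : X)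
    linarith [hxw j, hεj j, hw2 j]
  have hx'l : ∀ j, δ/2 ≤ ‖x' j‖ := by
    intro j
    have h1 := norm_sub_norm_le (T (w j)) (x' j)
    rw [norm_sub_rev] at h1
    linarith [hx'w j, hεj j, hTz (kf (q j) j)]
  have hx'u : ∀ j, ‖x' j‖ ≤ ‖T‖ * 2 + ε₀ := by
    intro j
    have h1 := norm_sub_norm_le (x' j) (T (w j))
    have h2 : ‖T (w j)‖ ≤ ‖T‖ * 2 := (T.le_opNorm _).trans (by gcongr; exact hB _)
    linarith [hx'w j, hεj j]
  have hxblock : ∀ j, x j = ∑ i ∈ Finset.Ico (q j) (q (j+1)), u' i (x j) • u i := by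
    intro j
    have h1 : x j = ∑ i ∈ Finset.range (q (j+1)), u' i (x j) • u i :=
      h.RRPP_eq (q j) (q (j+1)) (hq (Nat.lt_succ_self j)) (w j)
    rw [← Finset.sum_range_add_sum_Ico _ (hq (Nat.lt_succ_self j)).le,
      Finset.sum_eq_zero (s := Finset.range (q j)), zero_add] at h1
    · exact h1
    · intro i hi
      have : u' i (x j) = 0 := h.RR_coord_lt (q j) _ i (Finset.mem_range.1 hi)
      rw [this, zero_smul]
  have hPu : ∀ m i, PP u u' m (u i) = if i < m then u i else 0 := by
    intro m i
    rw [PP_apply]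
    simp only [h.bi, ite_smul, one_smul, zero_smul]
    rw [Finset.sum_ite_eq']
    simp
  have hPx1 : ∀ m j, q (j+1) ≤ m → PP u u' m (x j) = x j := by
    intro m j hm
    rw [hxblock j, map_sum]
    apply Finset.sum_congr rfl
    intro i hi
    have := Finset.mem_Ico.1 hi
    rw [map_smul, hPu, if_pos (by omega)]
  have hPx0 : ∀ m j, m ≤ q j → PP u u' m (x j) = 0 := by
    intro m j hm
    rw [hxblock j, map_sum]
    apply Finset.sum_eq_zero
    intro i hi
    have := Finset.mem_Ico.1 hi
    rw [map_smul, hPu, if_neg (by omega), smul_zero]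
  refine ⟨x, x', ?_, ?_, ⟨d/2, 2 + ε₀, by positivity, fun i => ⟨hxl i, hxu i⟩⟩,
    ⟨δ/2, ‖T‖ * 2 + ε₀, by positivity, fun i => ⟨hx'l i, hx'u i⟩⟩, ?_, ?_⟩
  · obtain ⟨a, ha⟩ := glue q hq (fun n i => u' i (x n))
    refine ⟨q, hq, a, fun n => ⟨?_, ?_⟩⟩
    · intro h0
      have := hxl n
      rw [h0, norm_zero] at this
      linarith
    · rw [Finset.sum_congr rfl (fun i hi => by rw [ha n i hi])]
      exact hxblock n
  · obtain ⟨a, ha⟩ := glue q hq (fun n i => T (w n) (u i))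
    refine ⟨q, hq, a, fun n => ⟨?_, ?_⟩⟩
    · intro h0
      have := hx'l n
      rw [h0, norm_zero] at this
      linarith
    · exact Finset.sum_congr rfl (fun i hi => by rw [ha n i hi])
  · refine ⟨4 + 5 * ‖T‖, fun s a => ?_⟩
    set A := ‖∑ i ∈ s, a i • x i‖ with hA
    have hA0 : 0 ≤ A := norm_nonneg _
    have hai : ∀ i ∈ s, |a i| ≤ 4 * A / d := by
      intro i hi
      have e1 : PP u u' (q (i+1)) (∑ j ∈ s, a j • x j) - PP u u' (q i) (∑ j ∈ s, a j • x j)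
          = a i • x i := by
        rw [map_sum, map_sum, ← Finset.sum_sub_distrib, Finset.sum_eq_single i]
        · rw [map_smul, map_smul, hPx1 _ _ le_rfl, hPx0 _ _ le_rfl, smul_zero, sub_zero]
        · intro j _ hji
          rw [map_smul, map_smul]
          rcases lt_or_gt_of_ne hji with hlt | hlt
          · have : q (j+1) ≤ q i := hq.monotone (show j+1 ≤ i from hlt)
            rw [hPx1 _ _ this, hPx1 _ _ (this.trans (hq (Nat.lt_succ_self i)).le), sub_self]
          · have : q (i+1) ≤ q j := hq.monotone (show i+1 ≤ j from hlt)
            rw [hPx0 _ _ this, hPx0 _ _ ((hq (Nat.lt_succ_self i)).le.trans this), sub_self]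
        · intro hn; exact absurd hi hn
      have e2 : ‖a i • x i‖ ≤ 2 * A := by
        rw [← e1]
        have := norm_sub_le (PP u u' (q (i+1)) (∑ j ∈ s, a j • x j)) (PP u u' (q i) (∑ j ∈ s, a j • x j))
        have := h.PP_le (q (i+1)) (∑ j ∈ s, a j • x j)
        have := h.PP_le (q i) (∑ j ∈ s, a j • x j)
        linarith
      rw [norm_smul, Real.norm_eq_abs] at e2
      rw [le_div_iff₀ hd0]
      nlinarith [hxl i, abs_nonneg (a i)]
    have hsum : ∑ i ∈ s, |a i| * (ε₀ * (1/2)^i) ≤ 4 * A := by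
      refine (sum_eps s ε₀ (4 * A / d) hε₀p.le (by positivity) a hai).trans ?_
      calc 2 * ε₀ * (4 * A / d) ≤ 2 * (d/2) * (4 * A / d) := by gcongr
        _ = 4 * A := by field_simp
    have b1 : ‖∑ i ∈ s, a i • (x i - (w i : X))‖ ≤ 4 * A := by
      refine (norm_sum_le _ _).trans (le_trans (Finset.sum_le_sum fun i _ => ?_) hsum)
      rw [norm_smul, Real.norm_eq_abs]
      gcongr
      exact hxw i
    have b2 : ‖∑ i ∈ s, a i • (x' i - T (w i))‖ ≤ 4 * A := by
      refine (norm_sum_le _ _).trans (le_trans (Finset.sum_le_sum fun i _ => ?_) hsum)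
      rw [norm_smul, Real.norm_eq_abs]
      gcongr
      exact hx'w i
    have b3 : ‖∑ i ∈ s, a i • w i‖ ≤ 5 * A := by
      have : ‖((∑ i ∈ s, a i • w i : Y) : X)‖ ≤ 5 * A := by
        have e : ((∑ i ∈ s, a i • w i : Y) : X) = ∑ i ∈ s, a i • x i - ∑ i ∈ s, a i • (x i - (w i : X)) := by
          rw [← Finset.sum_sub_distrib]
          push_cast
          apply Finset.sum_congr rfl
          intro i _
          rw [← smul_sub, sub_sub_cancel]
        rw [e]
        refine (norm_sub_le _ _).trans ?_
        linarith
      exact this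
    have e : ∑ i ∈ s, a i • x' i = ∑ i ∈ s, a i • (x' i - T (w i)) + T (∑ i ∈ s, a i • w i) := by
      rw [map_sum, ← Finset.sum_add_distrib]
      apply Finset.sum_congr rfl
      intro i _
      rw [map_smul, ← smul_add, sub_add_cancel]
    rw [e]
    have b4 : ‖T (∑ i ∈ s, a i • w i)‖ ≤ ‖T‖ * (5 * A) := (T.le_opNorm _).trans (by gcongr)
    refine (norm_add_le _ _).trans ?_
    linarith
  · intro i
    exact h.S_RR _ _

end

/-- Lemma 2 of the paper. -/
theorem statement1 {E X : Type*} [NormedAddCommGroup E] [NormedSpace ℝ E] [CompleteSpace E]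
    [NormedAddCommGroup X] [NormedSpace ℝ X] [CompleteSpace X]
    (e : ℕ → E) (he : IsNormalizedUnconditionalBasic e) (hsh : IsShrinking e)
    (u : ℕ → X) (hJ : IsJamesSpace e u)
    (u' : ℕ → X →L[ℝ] ℝ) (hu' : ∀ i j, u' i (u j) = if i = j then 1 else 0)
    (S : X →L[ℝ] ℝ) (hS : ∀ i, S (u i) = 1)
    (Y : Submodule ℝ X) (hY : IsClosed (Y : Set X))
    (T : Y →L[ℝ] (X →L[ℝ] ℝ)) (hT : ¬ IsCompactOp T) :
    ∃ (x : ℕ → X) (x' : ℕ → X →L[ℝ] ℝ),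
      IsBlockBasis u x ∧ IsBlockBasis u' x' ∧ SemiNormalized x ∧ SemiNormalized x' ∧
      Dominates x x' ∧ ∀ i, S (x i) = 0 := by
  obtain ⟨he1, C, hC⟩ := he
  obtain ⟨e', hb, hd⟩ := hsh
  obtain ⟨hdense, hnorm⟩ := hJ
  let f : ℕ → (Submodule.span ℝ (Set.range e)).topologicalClosure := fun j =>
    ⟨e j, Submodule.le_topologicalClosure _ (Submodule.subset_span (Set.mem_range_self j))⟩
  have hf1 : ∀ i, ‖f i‖ = 1 := he1
  have hsumn : ∀ (s : Finset ℕ) (a : ℕ → ℝ) (p : ℕ → ℕ),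
      ‖∑ i ∈ s, a i • f (p i)‖ = ‖∑ i ∈ s, a i • e (p i)‖ := by
    intro s a p
    rw [← Submodule.norm_coe]
    push_cast
    rfl
  have hCf : ∀ S F : Finset ℕ, S ⊆ F → ∀ a : ℕ → ℝ,
      ‖∑ i ∈ S, a i • f i‖ ≤ C * ‖∑ i ∈ F, a i • f i‖ := by
    intro S F hSF a
    have h1 := hsumn S a id
    have h2 := hsumn F a id
    simp only [id] at h1 h2
    rw [h1, h2]
    exact hC S F hSF a
  have hj : ∀ a, jamesNorm f a = jamesNorm e a := by
    intro a
    simp only [jamesNorm]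
    congr 1
    ext r
    constructor
    · rintro ⟨k, p, h1, h2, h3, rfl⟩
      exact ⟨k, p, h1, h2, h3, hsumn _ _ _⟩
    · rintro ⟨k, p, h1, h2, h3, rfl⟩
      exact ⟨k, p, h1, h2, h3, (hsumn _ _ _).symm⟩
  have hdesc := james_desc f hf1 u (fun a => by rw [hj]; exact hnorm a)
  have core : Core u u' S :=
    { bi := hu'
      dense := hdense
      mono := by
        intro a n N hn
        apply (hdesc a n).2
        intro D m hm
        exact (hdesc a N).1 D m (hm.trans hn)
      le_one := by
        intro n
        have h1 := (hdesc (fun j => if j = n then 1 else 0) (n+1)).2 1 (by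
          intro D m _
          refine (LL_norm_le f hf1 _ _ _).trans ?_
          have : ∀ j, |(if j = n then (1:ℝ) else 0)| = if j = n then 1 else 0 := by
            intro j; split_ifs <;> simp
          simp_rw [this]
          rw [Finset.sum_ite_eq']
          split_ifs <;> norm_num)
        simpa using h1
      hS := hS }
  exact core.main (fun g δ hδ => core.RR_null f hf1 C hCf e' hb hd hdesc g δ hδ) Y hY T hT
end

section
/- Let (e_i) be a right dominant normalized unconditional basic sequence in a Banach space which dominates every one of its normalized block bases, let E be the closed linear span of (e_i) with biorthogonal functionals (e_i') ⊆ E', and let X = J(e_i) be the James-type space over (e_i). Then the following are equivalent: (a) for every closed subspace Y of X, every bounded linear operator from Y into X' is compact; (b) (e_i) does not dominate (e_i'). -/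
open Filter Topology

section helpers

variable {E : Type*} [NormedAddCommGroup E] [NormedSpace ℝ E]

/-- Working form of unconditionality. -/
def UBd (e : ℕ → E) (K : ℝ) : Prop :=
  1 ≤ K ∧ ∀ (p : ℕ → ℕ) (s t : Finset ℕ) (b c : ℕ → ℝ), s ⊆ t → Set.InjOn p t →
    (∀ i ∈ s, |c i| ≤ |b i|) →
    ‖∑ i ∈ s, c i • e (p i)‖ ≤ K * ‖∑ i ∈ t, b i • e (p i)‖

lemma exists_UBd (e : ℕ → E) (he : IsNormalizedUnconditionalBasic e) : ∃ K, UBd e K := by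
  obtain ⟨hn, C, hC⟩ := he
  have hC1 : 1 ≤ C := by
    have := hC {0} {0} (le_refl _) (fun _ => 1)
    simpa [hn] using this
  refine ⟨2 * C, by linarith, ?_⟩
  intro p s t b c hst hp hcb
  have hC' : ∀ S ⊆ t, ‖∑ i ∈ S, b i • e (p i)‖ ≤ C * ‖∑ i ∈ t, b i • e (p i)‖ := by
    intro S hS
    have key : ∀ R ⊆ t, ∑ i ∈ R, b i • e (p i) =
        ∑ x ∈ R.image p, b (Function.invFunOn p t x) • e x := by
      intro R hR
      rw [Finset.sum_image (fun x hx y hy h => hp (hR hx) (hR hy) h)]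
      refine Finset.sum_congr rfl fun i hi => ?_
      rw [hp.leftInvOn_invFunOn (hR hi)]
    rw [key S hS, key t (le_refl _)]
    exact hC _ _ (Finset.image_subset_image hS) _
  obtain ⟨f, hf1, hf2⟩ := exists_dual_vector'' ℝ (∑ i ∈ s, c i • e (p i))
  have h1 : ‖∑ i ∈ s, c i • e (p i)‖ = f (∑ i ∈ s, c i • e (p i)) := by
    rw [hf2]; rfl
  have hle : ∀ x, |f x| ≤ ‖x‖ := fun x => by
    have := f.le_opNorm x
    rw [Real.norm_eq_abs] at this
    nlinarith [norm_nonneg x]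
  rw [h1, map_sum]
  have h2 : ∀ i ∈ s, f (c i • e (p i)) ≤ |f (b i • e (p i))| := by
    intro i hi
    refine (le_abs_self _).trans ?_
    simp only [map_smul, smul_eq_mul, abs_mul]
    exact mul_le_mul_of_nonneg_right (hcb i hi) (abs_nonneg _)
  refine (Finset.sum_le_sum h2).trans ?_
  rw [← Finset.sum_filter_add_sum_filter_not s (fun i => 0 ≤ f (b i • e (p i)))]
  have h3 : ∑ i ∈ s with 0 ≤ f (b i • e (p i)), |f (b i • e (p i))| ≤
      C * ‖∑ i ∈ t, b i • e (p i)‖ := by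
    refine le_trans ?_ (hC' (s.filter fun i => 0 ≤ f (b i • e (p i)))
      ((Finset.filter_subset _ _).trans hst))
    refine le_trans ?_ (hle _)
    refine le_trans (le_of_eq ?_) (le_abs_self _)
    rw [map_sum]
    exact Finset.sum_congr rfl fun i hi => abs_of_nonneg (Finset.mem_filter.1 hi).2
  have h4 : ∑ i ∈ s with ¬ 0 ≤ f (b i • e (p i)), |f (b i • e (p i))| ≤
      C * ‖∑ i ∈ t, b i • e (p i)‖ := by
    refine le_trans ?_ (hC' (s.filter fun i => ¬ 0 ≤ f (b i • e (p i)))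
      ((Finset.filter_subset _ _).trans hst))
    refine le_trans ?_ (hle _)
    refine le_trans (le_of_eq ?_) (neg_le_abs _)
    rw [map_sum, ← Finset.sum_neg_distrib]
    exact Finset.sum_congr rfl fun i hi =>
      abs_of_neg (not_le.1 (Finset.mem_filter.1 hi).2)
  linarith

lemma UBd.le {e : ℕ → E} {K : ℝ} (h : UBd e K) (s t : Finset ℕ) (b c : ℕ → ℝ)
    (hz : ∀ i ∈ s, i ∉ t → b i = 0) (hcb : ∀ i ∈ s, |c i| ≤ |b i|) :
    ‖∑ i ∈ s, c i • e i‖ ≤ K * ‖∑ i ∈ t, b i • e i‖ := by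
  have h1 : ∑ i ∈ t, b i • e i = ∑ i ∈ s ∪ t, b i • e i := by
    refine Finset.sum_subset Finset.subset_union_right ?_
    intro i hi hit
    rw [hz i (by simpa [hit] using hi) hit, zero_smul]
  rw [h1]
  exact h.2 id s (s ∪ t) b c Finset.subset_union_left Function.injective_id.injOn hcb

lemma UBd.leM {e : ℕ → E} {K : ℝ} (h : UBd e K) (s : Finset ℕ) (b c : ℕ → ℝ) (M : ℝ)
    (hM : 0 ≤ M) (hcb : ∀ i ∈ s, |c i| ≤ M * |b i|) :
    ‖∑ i ∈ s, c i • e i‖ ≤ K * M * ‖∑ i ∈ s, b i • e i‖ := by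
  have := h.le s s (fun i => M * b i) c (fun i h1 h2 => absurd h1 h2)
    (fun i hi => by rw [abs_mul, abs_of_nonneg hM]; exact hcb i hi)
  simp only [mul_smul, ← Finset.smul_sum, norm_smul, Real.norm_eq_abs, abs_of_nonneg hM] at this
  linarith

lemma UBd.coef {e : ℕ → E} {K : ℝ} (h : UBd e K) (hn : ∀ i, ‖e i‖ = 1) (s : Finset ℕ)
    (b : ℕ → ℝ) (i : ℕ) (hi : i ∈ s) : |b i| ≤ K * ‖∑ i ∈ s, b i • e i‖ := by
  have := h.le {i} s b b (by simp [hi]) (fun i hi => le_rfl)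
  simpa [norm_smul, hn] using this

/-- finite form of right dominance -/
lemma rd_finset {e : ℕ → E} (hrd : RightDominantBound e) : ∃ C : ℝ, 0 ≤ C ∧
    ∀ (S : Finset ℕ) (m n : ℕ → ℕ) (a : ℕ → ℝ), (∀ i ∈ S, m i ≤ n i) →
      (∀ i ∈ S, ∀ j ∈ S, i < j → n i < m j) →
      ‖∑ i ∈ S, a i • e (m i)‖ ≤ C * ‖∑ i ∈ S, a i • e (n i)‖ := by
  classical
  obtain ⟨C, hC⟩ := hrd
  refine ⟨|C|, abs_nonneg _, ?_⟩
  intro S m n a h1 h2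
  set B := S.sup id + 1 with hB
  set D := S.sup n + 1 with hD
  have hSB : ∀ i ∈ S, i < B := fun i hi => Nat.lt_succ_of_le (Finset.le_sup (f := id) hi)
  have hSD : ∀ i ∈ S, n i < D := fun i hi => Nat.lt_succ_of_le (Finset.le_sup (f := n) hi)
  let P : ℕ → Prop := fun i => i ∈ S ∨ B ≤ i
  have hP : (Set.ofPred P).Infinite := by
    refine Set.infinite_of_forall_exists_gt fun k => ⟨max B (k+1), Or.inr (le_max_left _ _), ?_⟩
    exact lt_of_lt_of_le (Nat.lt_succ_self k) (le_max_right _ _)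
  let m' : ℕ → ℕ := fun i => if i ∈ S then m i else D + i
  let n' : ℕ → ℕ := fun i => if i ∈ S then n i else D + i
  have hm' : ∀ i, m' i ≤ n' i := by
    intro i
    by_cases hi : i ∈ S
    · simp only [m', n', hi, if_true]; exact h1 i hi
    · simp [m', n', hi]
  have hmn' : ∀ i j, P i → P j → i < j → n' i < m' j := by
    intro i j hi hj hij
    by_cases hiS : i ∈ S <;> by_cases hjS : j ∈ S
    · simp only [m', n', hiS, hjS, if_true]; exact h2 i hiS j hjS hij
    · simp only [m', n', hiS, hjS, if_true, if_false]; have := hSD i hiS; omega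
    · have := hSB j hjS
      rcases hi with hi | hi
      · exact absurd hi hiS
      · omega
    · simp only [m', n', hiS, hjS, if_false]; omega
  have hmono := Nat.nth_strictMono hP
  have key := hC (m' ∘ Nat.nth P) (n' ∘ Nat.nth P) (fun i => hm' _)
    (fun i => hmn' _ _ (Nat.nth_mem_of_infinite hP _) (Nat.nth_mem_of_infinite hP _)
      (hmono (Nat.lt_succ_self i)))
    (S.preimage (Nat.nth P) hmono.injective.injOn) (a ∘ Nat.nth P)
  have conv : ∀ g : ℕ → E, ∑ i ∈ S.preimage (Nat.nth P) hmono.injective.injOn, g (Nat.nth P i)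
      = ∑ i ∈ S, g i := by
    intro g
    refine Finset.sum_preimage (Nat.nth P) S hmono.injective.injOn g ?_
    intro x hx hx'
    exact absurd (Nat.range_nth_of_infinite hP ▸ (Or.inl hx : P x) : x ∈ Set.range (Nat.nth P)) hx'
  have c1 := conv (fun i => a i • e (m' i))
  have c2 := conv (fun i => a i • e (n' i))
  simp only [Function.comp] at key
  rw [c1, c2] at key
  have d1 : ∑ i ∈ S, a i • e (m' i) = ∑ i ∈ S, a i • e (m i) :=
    Finset.sum_congr rfl fun i hi => by simp [m', hi]
  have d2 : ∑ i ∈ S, a i • e (n' i) = ∑ i ∈ S, a i • e (n i) :=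
    Finset.sum_congr rfl fun i hi => by simp [n', hi]
  rw [d1, d2] at key
  exact key.trans (mul_le_mul_of_nonneg_right (le_abs_self C) (norm_nonneg _))

/-- index of the block containing `m` -/
def bidx (q : ℕ → ℕ) (m : ℕ) : ℕ := Nat.findGreatest (fun n => q n ≤ m) m

lemma bidx_spec {q : ℕ → ℕ} (hq : StrictMono q) (h0 : q 0 = 0) (m : ℕ) :
    q (bidx q m) ≤ m ∧ m < q (bidx q m + 1) := by
  refine ⟨Nat.findGreatest_spec (P := fun n => q n ≤ m) (Nat.zero_le m) (by simp [h0]), ?_⟩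
  by_contra h
  push Not at h
  have h1 : bidx q m + 1 ≤ m := (hq.id_le _).trans h
  have := Nat.le_findGreatest (P := fun n => q n ≤ m) h1 h
  change bidx q m + 1 ≤ bidx q m at this
  omega

lemma bidx_eq {q : ℕ → ℕ} (hq : StrictMono q) (n m : ℕ) (h1 : q n ≤ m) (h2 : m < q (n+1)) :
    bidx q m = n := by
  have h3 : n ≤ m := (hq.id_le n).trans h1
  have h4 : n ≤ bidx q m := Nat.le_findGreatest (P := fun n => q n ≤ m) h3 h1
  have h5 : q (bidx q m) ≤ m :=
    Nat.findGreatest_spec (P := fun n => q n ≤ m) h3 h1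
  have := hq.lt_iff_lt.1 (h5.trans_lt h2)
  omega

lemma Dominates.nn {F : Type*} [NormedAddCommGroup F] [NormedSpace ℝ F] {e : ℕ → E} {v : ℕ → F}
    (h : Dominates e v) : ∃ C : ℝ, 0 ≤ C ∧ ∀ (s : Finset ℕ) (a : ℕ → ℝ),
      ‖∑ i ∈ s, a i • v i‖ ≤ C * ‖∑ i ∈ s, a i • e i‖ := by
  obtain ⟨C, hC⟩ := h
  exact ⟨|C|, abs_nonneg _, fun s a => (hC s a).trans
    (mul_le_mul_of_nonneg_right (le_abs_self C) (norm_nonneg _))⟩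

/-- uniform domination of blocks -/
lemma unif_blocks [CompleteSpace E] {e : ℕ → E} {K : ℝ} (hK : UBd e K) (hn : ∀ i, ‖e i‖ = 1)
    (hblock : ∀ v : ℕ → E, IsBlockBasis e v → (∀ n, ‖v n‖ = 1) → Dominates e v)
    (q : ℕ → ℕ) (hq : StrictMono q) :
    ∃ C : ℝ, 0 ≤ C ∧ ∀ f : ℕ → E,
      (∀ n, f n ∈ Submodule.span ℝ (e '' (Finset.Ico (q n) (q (n+1)) : Set ℕ))) →
      (∀ n, ‖f n‖ ≤ 1) → ∀ (s : Finset ℕ) (b : ℕ → ℝ),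
        ‖∑ n ∈ s, b n • f n‖ ≤ C * ‖∑ n ∈ s, b n • e n‖ := by
  classical
  let F : ℕ → Submodule ℝ E := fun n => Submodule.span ℝ (e '' (Finset.Ico (q n) (q (n+1)) : Set ℕ))
  have hfd : ∀ n, FiniteDimensional ℝ (F n) := fun n =>
    FiniteDimensional.span_of_finite ℝ ((Finset.finite_toSet _).image _)
  have hcs : ∀ n, CompleteSpace (F n) := fun n => FiniteDimensional.complete ℝ _
  -- pointwise
  have pw : ∀ (f : ℕ → E) (M : ℝ), (∀ n, f n ∈ F n) → (∀ n, ‖f n‖ ≤ M) → Dominates e f := by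
    intro f M hf hM
    have hM0 : 0 ≤ M := (norm_nonneg _).trans (hM 0)
    have hself : ∀ n, e (q n) ∈ F n := fun n =>
      Submodule.subset_span ⟨q n, by simpa using hq (Nat.lt_succ_self n), rfl⟩
    let v : ℕ → E := fun n => if f n = 0 then e (q n) else (‖f n‖⁻¹) • f n
    have hv1 : ∀ n, ‖v n‖ = 1 := by
      intro n
      by_cases h : f n = 0
      · simp [v, h, hn]
      · simp [v, h, norm_smul, norm_ne_zero_iff.2 h]
    have hvF : ∀ n, v n ∈ F n := by
      intro n
      by_cases h : f n = 0
      · simp only [v, h, if_true]; exact hself n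
      · simp only [v, h, if_false]; exact (F n).smul_mem _ (hf n)
    have hfv : ∀ n, f n = ‖f n‖ • v n := by
      intro n
      by_cases h : f n = 0
      · simp [h]
      · simp [v, h, smul_smul, norm_ne_zero_iff.2 h]
    have hco : ∀ n, ∃ c : ℕ → ℝ, ∑ i ∈ Finset.Ico (q n) (q (n+1)), c i • e i = v n := by
      intro n
      exact (Submodule.mem_span_image_finset_iff_exists_fun' ℝ).1 (hvF n)
    choose c hc using hco
    have hvd := hblock v ⟨q, hq, fun i => c (bidx q i) i, fun n => ⟨fun h => by
      have := hv1 n; rw [h] at this; simp at this, by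
      rw [← hc n]
      refine Finset.sum_congr rfl fun i hi => ?_
      rw [Finset.mem_Ico] at hi
      simp only [bidx_eq hq n i hi.1 hi.2]⟩⟩ hv1
    obtain ⟨C, hC0, hC⟩ := hvd.nn
    refine ⟨C * (K * M), fun s a => ?_⟩
    have e1 : ∑ i ∈ s, a i • f i = ∑ i ∈ s, (a i * ‖f i‖) • v i :=
      Finset.sum_congr rfl fun i _ => by rw [mul_smul, ← hfv]
    rw [e1, mul_assoc]
    refine (hC s _).trans (mul_le_mul_of_nonneg_left ?_ hC0)
    refine hK.leM s a _ M hM0 fun i _ => ?_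
    rw [abs_mul, abs_of_nonneg (norm_nonneg _), mul_comm]
    exact mul_le_mul_of_nonneg_right (hM i) (abs_nonneg _)
  let ι := {x : Finset ℕ × (ℕ → ℝ) // ‖∑ n ∈ x.1, x.2 n • e n‖ ≤ 1}
  let Z := lp (fun n => F n) ⊤
  have hb : ∀ n (z : Z), ‖z n‖ ≤ ‖z‖ := fun n z => lp.norm_apply_le_norm (by simp) z n
  let ev : ∀ n, Z →L[ℝ] E := fun n => (F n).subtypeL ∘L lp.evalCLM ℝ (fun n => F n) ⊤ n
  let g : ι → (Z →L[ℝ] E) := fun x => ∑ n ∈ x.1.1, x.1.2 n • ev n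
  have hgapp : ∀ x z, g x z = ∑ n ∈ x.1.1, x.1.2 n • ((z n : F n) : E) := by
    intro x z
    simp only [g, sum_apply, smul_apply]
    rfl
  obtain ⟨C, hC⟩ := banach_steinhaus (g := g) (by
    intro z
    obtain ⟨C, hC0, hC⟩ := (pw (fun n => ((z n : F n) : E)) ‖z‖ (fun n => (z n).2)
      (fun n => hb n z)).nn
    refine ⟨C, fun x => ?_⟩
    rw [hgapp]
    refine (hC _ _).trans ?_
    have := x.2
    nlinarith)
  refine ⟨|C|, abs_nonneg _, ?_⟩
  intro f hf hf1 s b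
  have hmem : Memℓp (fun n => (⟨f n, hf n⟩ : F n)) ⊤ :=
    memℓp_infty ⟨1, by rintro _ ⟨n, rfl⟩; exact hf1 n⟩
  let z : Z := ⟨fun n => ⟨f n, hf n⟩, hmem⟩
  have hz : ‖z‖ ≤ 1 := lp.norm_le_of_forall_le zero_le_one (fun n => hf1 n)
  have main : ∀ c : ℕ → ℝ, ‖∑ n ∈ s, c n • e n‖ ≤ 1 → ‖∑ n ∈ s, c n • f n‖ ≤ |C| := by
    intro c hc
    have h1 := (g ⟨(s, c), hc⟩).le_opNorm z
    rw [hgapp] at h1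
    refine h1.trans ?_
    have h2 := hC ⟨(s, c), hc⟩
    have h3 := le_abs_self C
    have h4 := abs_nonneg C
    have h5 := norm_nonneg (g ⟨(s, c), hc⟩)
    have h6 := norm_nonneg z
    nlinarith
  set r := ‖∑ n ∈ s, b n • e n‖ with hr
  by_cases h0 : r = 0
  · have : ∀ n ∈ s, b n = 0 := by
      intro n hns
      have := hK.coef hn s b n hns
      rw [← hr, h0, mul_zero] at this
      exact abs_nonpos_iff.1 this
    rw [Finset.sum_eq_zero (fun n hns => by rw [this n hns, zero_smul]), h0]
    simp
  · have hrpos : 0 < r := lt_of_le_of_ne (norm_nonneg _) (Ne.symm h0)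
    have := main (fun n => r⁻¹ * b n) (by
      simp only [mul_smul, ← Finset.smul_sum, norm_smul]
      rw [← hr, norm_inv, Real.norm_eq_abs, abs_of_pos hrpos, inv_mul_cancel₀ h0])
    simp only [mul_smul, ← Finset.smul_sum, norm_smul] at this
    rw [norm_inv, Real.norm_eq_abs, abs_of_pos hrpos] at this
    rwa [inv_mul_le_iff₀ hrpos, mul_comm] at this

lemma sum_blocks {G : Type*} [AddCommGroup G] (p : ℕ → ℕ) (hp : StrictMono p) (f : ℕ → G) (k : ℕ) :
    ∑ i ∈ Finset.range k, ∑ j ∈ Finset.Ico (p i) (p (i+1)), f j =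
      ∑ j ∈ Finset.Ico (p 0) (p k), f j := by
  induction k with
  | zero => simp
  | succ k ih =>
    rw [Finset.sum_range_succ, ih, Finset.sum_Ico_consecutive f (hp.monotone (Nat.zero_le k))
      (hp.monotone (Nat.le_succ k))]

section james
variable {X : Type*} [NormedAddCommGroup X] [NormedSpace ℝ X]

lemma james_l1 {e : ℕ → E} (hn : ∀ i, ‖e i‖ = 1) (t : Finset ℕ) (a : ℕ → ℝ)
    (ha : ∀ i, i ∉ t → a i = 0) (k : ℕ) (p : ℕ → ℕ) (hp : StrictMono p) :
    ‖∑ i ∈ Finset.range k, (∑ j ∈ Finset.Ico (p i) (p (i + 1)), a j) • e (p i)‖ ≤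
      ∑ i ∈ t, |a i| := by
  calc _ ≤ ∑ i ∈ Finset.range k, ∑ j ∈ Finset.Ico (p i) (p (i + 1)), |a j| := by
        refine (norm_sum_le _ _).trans (Finset.sum_le_sum fun i _ => ?_)
        rw [norm_smul, hn, mul_one, Real.norm_eq_abs]
        exact Finset.abs_sum_le_sum_abs _ _
    _ = ∑ j ∈ Finset.Ico (p 0) (p k), |a j| := sum_blocks p hp _ k
    _ ≤ ∑ j ∈ Finset.Ico (p 0) (p k) ∪ t, |a j| :=
        Finset.sum_le_sum_of_subset_of_nonneg Finset.subset_union_left fun _ _ _ => abs_nonneg _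
    _ = ∑ i ∈ t, |a i| := by
        refine (Finset.sum_subset Finset.subset_union_right ?_).symm
        intro i _ hi
        rw [ha i hi, abs_zero]

lemma james_eq {e : ℕ → E} {u : ℕ → X} (hJ : IsJamesSpace e u) (t : Finset ℕ) (a : ℕ → ℝ)
    (ha : ∀ i, i ∉ t → a i = 0) : ‖∑ i ∈ t, a i • u i‖ = jamesNorm e a := by
  classical
  have h := hJ.2 (Finsupp.onFinset t a (fun i hi => by
    by_contra h; exact hi (ha i h)))
  have h' : ∑ i ∈ t, a i • u i = ∑ i ∈ (Finsupp.onFinset t a (fun i hi => by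
      by_contra h; exact hi (ha i h))).support, a i • u i := by
    refine (Finset.sum_subset Finsupp.support_onFinset_subset fun i _ hi => ?_).symm
    have : a i = 0 := by simpa using hi
    rw [this, zero_smul]
  rw [h']
  simpa using h

lemma james_ge {e : ℕ → E} {u : ℕ → X} (hn : ∀ i, ‖e i‖ = 1) (hJ : IsJamesSpace e u)
    (t : Finset ℕ) (a : ℕ → ℝ) (ha : ∀ i, i ∉ t → a i = 0) (k : ℕ) (p : ℕ → ℕ) (hk : 0 < k)
    (h0 : p 0 = 0) (hp : StrictMono p) :
    ‖∑ i ∈ Finset.range k, (∑ j ∈ Finset.Ico (p i) (p (i + 1)), a j) • e (p i)‖ ≤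
      ‖∑ i ∈ t, a i • u i‖ := by
  rw [james_eq hJ t a ha]
  refine le_csSup ⟨∑ i ∈ t, |a i|, ?_⟩ ⟨k, p, hk, h0, hp, rfl⟩
  rintro _ ⟨k, p, hk, h0, hp, rfl⟩
  exact james_l1 hn t a ha k p hp

lemma james_le {e : ℕ → E} {u : ℕ → X} (hJ : IsJamesSpace e u)
    (t : Finset ℕ) (a : ℕ → ℝ) (ha : ∀ i, i ∉ t → a i = 0) (B : ℝ)
    (hB : ∀ (k : ℕ) (p : ℕ → ℕ), 0 < k → p 0 = 0 → StrictMono p →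
      ‖∑ i ∈ Finset.range k, (∑ j ∈ Finset.Ico (p i) (p (i + 1)), a j) • e (p i)‖ ≤ B) :
    ‖∑ i ∈ t, a i • u i‖ ≤ B := by
  rw [james_eq hJ t a ha]
  refine csSup_le ⟨_, 1, id, one_pos, rfl, strictMono_id, rfl⟩ ?_
  rintro _ ⟨k, p, hk, h0, hp, rfl⟩
  exact hB k p hk h0 hp

lemma james_partial {e : ℕ → E} {u : ℕ → X} (hn : ∀ i, ‖e i‖ = 1) (hJ : IsJamesSpace e u)
    (t : Finset ℕ) (a : ℕ → ℝ) (ha : ∀ i, i ∉ t → a i = 0) (m : ℕ) :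
    |∑ j ∈ Finset.Ico 0 m, a j| ≤ ‖∑ i ∈ t, a i • u i‖ := by
  rcases Nat.eq_zero_or_pos m with rfl | hm
  · simp
  · have := james_ge hn hJ t a ha 1 (fun i => i * m) one_pos (by simp)
      (fun i j h => Nat.mul_lt_mul_of_pos_right h hm)
    simpa [norm_smul, hn] using this

lemma james_norm_u {e : ℕ → E} {u : ℕ → X} (hn : ∀ i, ‖e i‖ = 1) (hJ : IsJamesSpace e u)
    (i : ℕ) : ‖u i‖ ≤ 1 := by
  have := james_le hJ {i} (fun j => if j = i then 1 else 0) (by simp) 1 (fun k p _ _ hp => by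
    have := james_l1 hn {i} (fun j => if j = i then (1:ℝ) else 0) (by simp) k p hp
    simpa using this)
  simpa using this

lemma james_ge_e {e : ℕ → E} {u : ℕ → X} (hn : ∀ i, ‖e i‖ = 1) (hJ : IsJamesSpace e u)
    (N : ℕ) (a : ℕ → ℝ) (ha : ∀ i, N ≤ i → a i = 0) :
    ‖∑ i ∈ Finset.range N, a i • e i‖ ≤ ‖∑ i ∈ Finset.range N, a i • u i‖ := by
  rcases Nat.eq_zero_or_pos N with rfl | hm
  · simp
  · have := james_ge hn hJ (Finset.range N) a (fun i hi => ha i (by simpa using hi)) N id hm rfl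
      strictMono_id
    simpa using this

lemma james_upper [CompleteSpace E] {e : ℕ → E} {u : ℕ → X} {K : ℝ} (hK : UBd e K)
    (hn : ∀ i, ‖e i‖ = 1) (hrd : RightDominantBound e)
    (hblock : ∀ v : ℕ → E, IsBlockBasis e v → (∀ n, ‖v n‖ = 1) → Dominates e v)
    (hJ : IsJamesSpace e u) (q : ℕ → ℕ) (hq : StrictMono q) (q0 : q 0 = 0) (a : ℕ → ℝ)
    (hz : ∀ n, ∑ i ∈ Finset.Ico (q n) (q (n+1)), a i = 0)
    (hv : ∀ n, ‖∑ i ∈ Finset.Ico (q n) (q (n+1)), a i • u i‖ ≤ 1) :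
    Dominates e (fun n => ∑ i ∈ Finset.Ico (q n) (q (n+1)), a i • u i) := by
  classical
  obtain ⟨CU, hCU0, hCU⟩ := unif_blocks hK hn hblock q hq
  obtain ⟨CR, hCR0, hCR⟩ := rd_finset hrd
  have hK1 := hK.1
  have hK0 : 0 ≤ K := by linarith
  refine ⟨K * CU * K + CR * (K * (CU * K)), fun s b0 => ?_⟩
  set b : ℕ → ℝ := fun n => if n ∈ s then b0 n else 0 with hb
  have hbz : ∀ n, n ∉ s → b n = 0 := fun n h => by simp [hb, h]
  have hse : ∑ n ∈ s, b0 n • e n = ∑ n ∈ s, b n • e n :=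
    Finset.sum_congr rfl fun n h => by simp [hb, h]
  rw [hse]
  set R := ‖∑ n ∈ s, b n • e n‖ with hR
  have hR0 : 0 ≤ R := norm_nonneg _
  have hbR : ∀ (t : Finset ℕ), ‖∑ n ∈ t, b n • e n‖ ≤ K * R := fun t =>
    hK.le t s b b (fun i _ h => hbz i h) (fun _ _ => le_rfl)
  set c : ℕ → ℝ := fun j => b (bidx q j) * a j with hc
  obtain ⟨N, hN⟩ : ∃ N, s ⊆ Finset.range N := ⟨s.sup id + 1, fun i hi => by
    simpa using Nat.lt_succ_of_le (Finset.le_sup (f := id) hi)⟩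
  have hspec := bidx_spec hq q0
  have hcz : ∀ i, i ∉ Finset.Ico 0 (q N) → c i = 0 := by
    intro i hi
    have hi : q N ≤ i := by simpa using hi
    have : N < bidx q i + 1 := hq.lt_iff_lt.1 (hi.trans_lt (hspec i).2)
    have : bidx q i ∉ s := fun h => by have := hN h; simp at this; omega
    simp [hc, hbz _ this]
  have cblock : ∀ n, ∀ j ∈ Finset.Ico (q n) (q (n+1)), c j = b n * a j := by
    intro n j hj
    rw [Finset.mem_Ico] at hj
    simp only [hc, bidx_eq hq n j hj.1 hj.2]
  have hsum : ∑ n ∈ s, b0 n • ∑ i ∈ Finset.Ico (q n) (q (n+1)), a i • u i =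
      ∑ i ∈ Finset.Ico 0 (q N), c i • u i := by
    rw [← q0, ← sum_blocks q hq]
    have : ∑ n ∈ s, b0 n • ∑ i ∈ Finset.Ico (q n) (q (n+1)), a i • u i =
        ∑ n ∈ s, b n • ∑ i ∈ Finset.Ico (q n) (q (n+1)), a i • u i :=
      Finset.sum_congr rfl fun n h => by simp [hb, h]
    rw [this, Finset.sum_subset hN (fun n _ h => by rw [hbz n h, zero_smul])]
    refine Finset.sum_congr rfl fun n _ => ?_
    rw [Finset.smul_sum]
    refine Finset.sum_congr rfl fun j hj => ?_
    rw [cblock n j hj, mul_smul]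
  rw [hsum]
  refine james_le hJ _ c hcz _ fun k p hk p0 hp => ?_
  -- single block as a sequence
  have hvn : ∀ n, ∑ j ∈ Finset.Ico (q n) (q (n+1)), a j • u j =
      ∑ j ∈ Finset.Ico (q n) (q (n+1)), (if bidx q j = n then a j else 0) • u j := by
    intro n
    refine Finset.sum_congr rfl fun j hj => ?_
    rw [Finset.mem_Ico] at hj
    rw [if_pos (bidx_eq hq n j hj.1 hj.2)]
  have hvz : ∀ n, ∀ j, j ∉ Finset.Ico (q n) (q (n+1)) → (if bidx q j = n then a j else 0) = 0 := by
    intro n j hj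
    rw [if_neg]
    rintro rfl
    exact hj (Finset.mem_Ico.2 (hspec j))
  set tt : ℕ → ℝ := fun i => ∑ j ∈ Finset.Ico (p i) (p (i+1)) with bidx q j = bidx q (p i), a j
    with htt
  set hh : ℕ → ℝ := fun i => ∑ j ∈ Finset.Ico (p i) (p (i+1)) with ¬ bidx q j = bidx q (p i), c j
    with hhh
  have hD : ∀ i, ∑ j ∈ Finset.Ico (p i) (p (i+1)), c j = b (bidx q (p i)) * tt i + hh i := by
    intro i
    rw [← Finset.sum_filter_add_sum_filter_not _ (fun j => bidx q j = bidx q (p i))]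
    congr 1
    rw [htt, Finset.mul_sum]
    refine Finset.sum_congr rfl fun j hj => ?_
    simp only [hc, (Finset.mem_filter.1 hj).2]
  -- part T
  have hT : ‖∑ i ∈ Finset.range k, (b (bidx q (p i)) * tt i) • e (p i)‖ ≤ K * CU * K * R := by
    set w : ℕ → E := fun n => ∑ i ∈ Finset.range k with bidx q (p i) = n, tt i • e (p i) with hw
    have hwn : ∀ n, ‖w n‖ ≤ K := by
      intro n
      have h1 : w n = ∑ i ∈ Finset.range k with bidx q (p i) = n,
          (∑ j ∈ Finset.Ico (p i) (p (i+1)), if bidx q j = n then a j else 0) • e (p i) := by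
        refine Finset.sum_congr rfl fun i hi => ?_
        rw [← Finset.sum_filter, htt]
        simp only [(Finset.mem_filter.1 hi).2]
      rw [h1]
      refine (hK.2 p _ (Finset.range k) (fun i => ∑ j ∈ Finset.Ico (p i) (p (i+1)),
        if bidx q j = n then a j else 0) _ (Finset.filter_subset _ _)
        hp.injective.injOn (fun _ _ => le_rfl)).trans ?_
      have h2 := james_ge hn hJ _ _ (hvz n) k p hk p0 hp
      rw [← hvn n] at h2
      have := h2.trans (hv n)
      nlinarith
    have hwm : ∀ n, w n ∈ Submodule.span ℝ (e '' (Finset.Ico (q n) (q (n+1)) : Set ℕ)) := by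
      intro n
      refine Submodule.sum_mem _ fun i hi => Submodule.smul_mem _ _ (Submodule.subset_span ?_)
      refine ⟨p i, ?_, rfl⟩
      rw [← (Finset.mem_filter.1 hi).2]
      exact Finset.mem_coe.2 (Finset.mem_Ico.2 (hspec (p i)))
    have h3 : ∑ i ∈ Finset.range k, (b (bidx q (p i)) * tt i) • e (p i) =
        ∑ n ∈ (Finset.range k).image (fun i => bidx q (p i)), b n • w n := by
      rw [← Finset.sum_fiberwise_of_maps_to
        (fun i hi => Finset.mem_image_of_mem (fun i => bidx q (p i)) hi)]
      refine Finset.sum_congr rfl fun n _ => ?_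
      rw [hw, Finset.smul_sum]
      refine Finset.sum_congr rfl fun i hi => ?_
      rw [(Finset.mem_filter.1 hi).2, mul_smul]
    have h4 := hCU (fun n => K⁻¹ • w n) (fun n => Submodule.smul_mem _ _ (hwm n)) (fun n => by
      rw [norm_smul, norm_inv, Real.norm_eq_abs, abs_of_nonneg hK0, inv_mul_le_iff₀ (by linarith)]
      simpa using hwn n) ((Finset.range k).image (fun i => bidx q (p i))) b
    simp only [smul_comm _ (K⁻¹), ← Finset.smul_sum] at h4
    rw [norm_smul, norm_inv, Real.norm_eq_abs, abs_of_nonneg hK0,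
      inv_mul_le_iff₀ (by linarith)] at h4
    rw [h3]
    refine h4.trans ?_
    have := mul_le_mul_of_nonneg_left (hbR ((Finset.range k).image (fun i => bidx q (p i))))
      (mul_nonneg hK0 hCU0)
    linarith
  -- part H
  have hAq : ∀ n, ∑ j ∈ Finset.Ico 0 (q n), c j = 0 := by
    intro n
    rw [← q0, ← sum_blocks q hq]
    refine Finset.sum_eq_zero fun l _ => ?_
    rw [Finset.sum_congr rfl (cblock l), ← Finset.mul_sum, hz, mul_zero]
  have hA : ∀ m, ∑ j ∈ Finset.Ico 0 m, c j =
      b (bidx q m) * ∑ j ∈ Finset.Ico (q (bidx q m)) m, a j := by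
    intro m
    rw [← Finset.sum_Ico_consecutive c (Nat.zero_le _) (hspec m).1, hAq, zero_add, Finset.mul_sum]
    refine Finset.sum_congr rfl fun j hj => cblock _ j ?_
    rw [Finset.mem_Ico] at hj ⊢
    exact ⟨hj.1, hj.2.trans (hspec m).2⟩
  have hal : ∀ m, |∑ j ∈ Finset.Ico (q (bidx q m)) m, a j| ≤ 1 := by
    intro m
    have h1 := james_partial hn hJ _ _ (hvz (bidx q m)) m
    rw [← hvn] at h1
    refine le_trans (le_of_eq ?_) (h1.trans (hv _))
    congr 1
    rw [← Finset.sum_filter]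
    refine Finset.sum_congr ?_ fun _ _ => rfl
    ext j
    simp only [Finset.mem_Ico, Finset.mem_filter]
    constructor
    · rintro ⟨h1, h2⟩
      exact ⟨⟨Nat.zero_le _, h2⟩, bidx_eq hq _ _ h1 (h2.trans (hspec m).2)⟩
    · rintro ⟨⟨_, h2⟩, h3⟩
      exact ⟨h3 ▸ (hspec j).1, h2⟩
  have hhI : ∀ i, hh i = ∑ j ∈ Finset.Ico (q (bidx q (p i) + 1)) (p (i+1)), c j := by
    intro i
    refine Finset.sum_congr ?_ fun _ _ => rfl
    ext j
    simp only [Finset.mem_Ico, Finset.mem_filter]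
    have s1 := hspec (p i)
    constructor
    · rintro ⟨⟨h1, h2⟩, h3⟩
      refine ⟨?_, h2⟩
      by_contra h
      exact h3 (bidx_eq hq _ _ (s1.1.trans h1) (not_le.1 h))
    · rintro ⟨h1, h2⟩
      refine ⟨⟨by omega, h2⟩, fun h => ?_⟩
      have := (hspec j).2
      rw [h] at this
      omega
  have hhA : ∀ i, q (bidx q (p i) + 1) ≤ p (i+1) → hh i = ∑ j ∈ Finset.Ico 0 (p (i+1)), c j := by
    intro i hi
    rw [hhI, ← Finset.sum_Ico_consecutive c (Nat.zero_le _) hi, hAq, zero_add]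
  set S := (Finset.range k).filter (fun i => q (bidx q (p i) + 1) < p (i+1) ∧
    q (bidx q (p (i+1))) < p (i+1)) with hS
  set Nf : ℕ → ℕ := fun i => bidx q (p (i+1)) with hNf
  have hH : ‖∑ i ∈ Finset.range k, hh i • e (p i)‖ ≤ CR * (K * (CU * K)) * R := by
    have h1 : ∑ i ∈ Finset.range k, hh i • e (p i) = ∑ i ∈ S, hh i • e (p i) := by
      symm
      refine Finset.sum_subset (Finset.filter_subset _ _) fun i hi hiS => ?_
      have : hh i = 0 := by
        by_cases h : q (bidx q (p i) + 1) < p (i+1)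
        · have h2 : ¬ q (bidx q (p (i+1))) < p (i+1) := fun h2 =>
            hiS (Finset.mem_filter.2 ⟨hi, h, h2⟩)
          have h3 := le_antisymm (hspec (p (i+1))).1 (not_lt.1 h2)
          rw [hhA i h.le, ← h3, hAq]
        · rw [hhI, Finset.Ico_eq_empty h, Finset.sum_empty]
      rw [this, zero_smul]
    have hSm : ∀ i ∈ S, ∀ j ∈ S, i < j → q (Nf i) < p j := by
      intro i hi j hj hij
      exact lt_of_lt_of_le (Finset.mem_filter.1 hi).2.2 (hp.monotone hij)
    have hSle : ∀ i ∈ S, p i < q (Nf i) := by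
      intro i hi
      have h1 := (Finset.mem_filter.1 hi).2.1
      have h2 : bidx q (p i) + 1 < Nf i + 1 := hq.lt_iff_lt.1 (h1.trans (hspec (p (i+1))).2)
      exact (hspec (p i)).2.trans_le (hq.monotone (by omega))
    have hNinj : Set.InjOn Nf S := by
      intro i hi j hj hij
      by_contra hne
      rcases lt_or_gt_of_ne hne with h | h
      · have := (hSm i hi j hj h).trans (hSle j hj)
        rw [hij] at this; exact lt_irrefl _ this
      · have := (hSm j hj i hi h).trans (hSle i hi)
        rw [hij] at this; exact lt_irrefl _ this
    rw [h1]
    refine (hCR S p (fun i => q (Nf i)) hh (fun i hi => (hSle i hi).le) hSm).trans ?_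
    rw [mul_assoc]
    refine mul_le_mul_of_nonneg_left ?_ hCR0
    have h2 : ‖∑ i ∈ S, hh i • e (q (Nf i))‖ ≤ K * ‖∑ i ∈ S, b (Nf i) • e (q (Nf i))‖ := by
      refine hK.2 (fun i => q (Nf i)) S S (fun i => b (Nf i)) hh le_rfl
        (hq.injective.comp_injOn hNinj) fun i hi => ?_
      rw [hhA i (Finset.mem_filter.1 hi).2.1.le, hA, abs_mul]
      exact mul_le_of_le_one_right (abs_nonneg _) (hal _)
    refine h2.trans ?_
    rw [mul_assoc]
    refine mul_le_mul_of_nonneg_left ?_ hK0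
    have h3 : ∑ i ∈ S, b (Nf i) • e (q (Nf i)) = ∑ n ∈ S.image Nf, b n • e (q n) := by
      rw [Finset.sum_image hNinj]
    rw [h3]
    refine (hCU (fun n => e (q n)) (fun n => Submodule.subset_span
      ⟨q n, by simpa using hq (Nat.lt_succ_self n), rfl⟩) (fun n => (hn _).le) _ b).trans ?_
    rw [mul_assoc]
    exact mul_le_mul_of_nonneg_left (hbR _) hCU0
  simp only [hD, add_smul, Finset.sum_add_distrib]
  refine (norm_add_le _ _).trans ?_
  linarith

end james
section seqs
variable {X : Type*} [NormedAddCommGroup X] [NormedSpace ℝ X]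

lemma lc_eq (u : ℕ → X) (a : ℕ →₀ ℝ) (t : Finset ℕ) (h : a.support ⊆ t) :
    Finsupp.linearCombination ℝ u a = ∑ i ∈ t, a i • u i := by
  rw [Finsupp.linearCombination_apply, Finsupp.sum_of_support_subset a h _ (by simp)]

lemma dom_perturb {e : ℕ → E} {K : ℝ} (hK : UBd e K) (hn : ∀ i, ‖e i‖ = 1) {v z : ℕ → X}
    (hv : Dominates e v) (B : ℝ) (hB : ∀ n, ‖z n - v n‖ ≤ B * (1/2)^n) : Dominates e z := by
  obtain ⟨C, hC0, hC⟩ := hv.nn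
  have hK0 : 0 ≤ K := by linarith [hK.1]
  have hB0 : 0 ≤ B := by have := (norm_nonneg _).trans (hB 0); simpa using this
  refine ⟨C + K * (B * 2), fun s a => ?_⟩
  have h1 : ∑ i ∈ s, a i • z i = ∑ i ∈ s, a i • v i + ∑ i ∈ s, a i • (z i - v i) := by
    rw [← Finset.sum_add_distrib]
    exact Finset.sum_congr rfl fun i _ => by rw [← smul_add]; simp
  rw [h1, add_mul]
  refine (norm_add_le _ _).trans (add_le_add (hC s a) ?_)
  set R := ‖∑ i ∈ s, a i • e i‖ with hR
  have hR0 : 0 ≤ R := norm_nonneg _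
  calc ‖∑ i ∈ s, a i • (z i - v i)‖ ≤ ∑ i ∈ s, (K * R) * (B * (1/2)^i) := by
        refine (norm_sum_le _ _).trans (Finset.sum_le_sum fun i hi => ?_)
        rw [norm_smul, Real.norm_eq_abs]
        exact mul_le_mul (hK.coef hn s a i hi) (hB i) (norm_nonneg _) (mul_nonneg hK0 hR0)
    _ = (K * R * B) * ∑ i ∈ s, ((1:ℝ)/2)^i := by
        rw [Finset.mul_sum]; exact Finset.sum_congr rfl fun i _ => by ring
    _ ≤ (K * R * B) * 2 := by
        refine mul_le_mul_of_nonneg_left ?_ (by positivity)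
        exact (Summable.sum_le_tsum s (fun i _ => by positivity) summable_geometric_two).trans
          tsum_geometric_two.le
    _ = K * (B * 2) * R := by ring

lemma dom_sub [CompleteSpace E] {e : ℕ → E} {K : ℝ} (hK : UBd e K) (hn : ∀ i, ‖e i‖ = 1)
    (hblock : ∀ v : ℕ → E, IsBlockBasis e v → (∀ n, ‖v n‖ = 1) → Dominates e v)
    {z : ℕ → X} (hz : Dominates e z) (φ : ℕ → ℕ) (hφ : StrictMono φ) :
    Dominates e (fun n => z (φ n)) := by
  classical
  obtain ⟨C, hC0, hC⟩ := hz.nn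
  obtain ⟨D, hD0, hD⟩ := unif_blocks hK hn hblock φ hφ
  have hD' := hD (fun n => e (φ n)) (fun n => Submodule.subset_span
      ⟨φ n, by simpa using hφ (Nat.lt_succ_self n), rfl⟩) (fun n => (hn _).le)
  refine ⟨C * D, fun s a => ?_⟩
  have conv : ∀ {G : Type _} [NormedAddCommGroup G] [NormedSpace ℝ G] (g : ℕ → G),
      ∑ i ∈ s, a i • g (φ i) = ∑ j ∈ s.image φ, a (Function.invFun φ j) • g j := by
    intro G _ _ g
    rw [Finset.sum_image hφ.injective.injOn]
    exact Finset.sum_congr rfl fun i _ => by rw [Function.leftInverse_invFun hφ.injective]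
  have h2 : ∑ i ∈ s, a i • e (φ i) = ∑ j ∈ s.image φ, a (Function.invFun φ j) • e j := by
    rw [Finset.sum_image hφ.injective.injOn]
    exact Finset.sum_congr rfl fun i _ => by rw [Function.leftInverse_invFun hφ.injective]
  rw [conv z]
  refine (hC _ _).trans ?_
  rw [← h2, mul_assoc]
  exact mul_le_mul_of_nonneg_left (hD' s a) hC0

lemma james_null_sub [CompleteSpace E] {e : ℕ → E} {u : ℕ → X} {K : ℝ} (hK : UBd e K)
    (hn : ∀ i, ‖e i‖ = 1) (hrd : RightDominantBound e)
    (hblock : ∀ v : ℕ → E, IsBlockBasis e v → (∀ n, ‖v n‖ = 1) → Dominates e v)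
    (hJ : IsJamesSpace e u) (d : ℕ → (ℕ →₀ ℝ)) (M : ℝ)
    (hM : ∀ k, ‖Finsupp.linearCombination ℝ u (d k)‖ ≤ M)
    (hco : ∀ j, Tendsto (fun k => d k j) atTop (𝓝 0))
    (hsg : Tendsto (fun k => Finsupp.linearCombination ℝ (fun _ : ℕ => (1:ℝ)) (d k)) atTop (𝓝 0)) :
    ∃ φ : ℕ → ℕ, StrictMono φ ∧
      Dominates e (fun n => Finsupp.linearCombination ℝ u (d (φ n))) := by
  classical
  have hF : ∀ n q k0 : ℕ, ∃ k, k0 < k ∧ ∑ j ∈ Finset.Ico 0 q, |d k j| ≤ (1/2:ℝ)^n ∧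
      |Finsupp.linearCombination ℝ (fun _ : ℕ => (1:ℝ)) (d k)| ≤ (1/2:ℝ)^n := by
    intro n q k0
    have h1 : Tendsto (fun k => ∑ j ∈ Finset.Ico 0 q, |d k j|) atTop (𝓝 0) := by
      have := tendsto_finsetSum (Finset.Ico 0 q) (fun j _ => (hco j).abs)
      simpa using this
    have h2 := hsg.abs
    rw [abs_zero] at h2
    have hpos : (0:ℝ) < (1/2)^n := by positivity
    obtain ⟨k, hk⟩ := ((eventually_gt_atTop k0).and ((h1.eventually_le_const hpos).and
      (h2.eventually_le_const hpos))).exists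
    exact ⟨k, hk⟩
  choose F hF1 hF2 hF3 using hF
  let L : ℕ → ℕ := fun k => (d k).support.sup id + 1
  have hL : ∀ k, (d k).support ⊆ Finset.Ico 0 (L k) := fun k i hi => by
    exact Finset.mem_Ico.2 ⟨Nat.zero_le _, Nat.lt_succ_of_le (Finset.le_sup (f := id) hi)⟩
  let st : ℕ → ℕ × ℕ := fun n => Nat.rec (F 0 0 0, 0)
    (fun n x => (F (n+1) (max x.2 (L x.1) + 1) x.1, max x.2 (L x.1) + 1)) n
  let φ : ℕ → ℕ := fun n => (st n).1
  let q : ℕ → ℕ := fun n => (st n).2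
  have q0 : q 0 = 0 := rfl
  have qs : ∀ n, q (n+1) = max (q n) (L (φ n)) + 1 := fun n => rfl
  have φs : ∀ n, φ (n+1) = F (n+1) (q (n+1)) (φ n) := fun n => rfl
  have hφ : StrictMono φ := strictMono_nat_of_lt_succ fun n => by rw [φs]; exact hF1 _ _ _
  have hq : StrictMono q := strictMono_nat_of_lt_succ fun n => by rw [qs]; omega
  have hqL : ∀ n, L (φ n) ≤ q (n+1) := fun n => by rw [qs]; omega
  have P1 : ∀ n, ∑ j ∈ Finset.Ico 0 (q n), |d (φ n) j| ≤ (1/2:ℝ)^n := by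
    intro n
    cases n with
    | zero => exact hF2 0 0 0
    | succ n => rw [φs]; exact hF2 _ _ _
  have P2 : ∀ n, |Finsupp.linearCombination ℝ (fun _ : ℕ => (1:ℝ)) (d (φ n))| ≤ (1/2:ℝ)^n := by
    intro n
    cases n with
    | zero => exact hF3 0 0 0
    | succ n => rw [φs]; exact hF3 _ _ _
  refine ⟨φ, hφ, ?_⟩
  have hsupp : ∀ n, (d (φ n)).support ⊆ Finset.Ico 0 (q (n+1)) := fun n =>
    (hL _).trans (Finset.Ico_subset_Ico_right (hqL n))
  let r : ℕ → ℝ := fun n => ∑ j ∈ Finset.Ico (q n) (q (n+1)), d (φ n) j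
  let a : ℕ → ℝ := fun i => d (φ (bidx q i)) i - if i = q (bidx q i) then r (bidx q i) else 0
  have ha : ∀ n, ∀ i ∈ Finset.Ico (q n) (q (n+1)),
      a i = d (φ n) i - if i = q n then r n else 0 := by
    intro n i hi
    rw [Finset.mem_Ico] at hi
    simp only [a, bidx_eq hq n i hi.1 hi.2]
  have hqmem : ∀ n, q n ∈ Finset.Ico (q n) (q (n+1)) := fun n => by
    simpa using hq (Nat.lt_succ_self n)
  have hz : ∀ n, ∑ i ∈ Finset.Ico (q n) (q (n+1)), a i = 0 := by
    intro n
    rw [Finset.sum_congr rfl (ha n), Finset.sum_sub_distrib, Finset.sum_ite_eq', if_pos (hqmem n)]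
    exact sub_self _
  have hv : ∀ n, ∑ i ∈ Finset.Ico (q n) (q (n+1)), a i • u i =
      ∑ i ∈ Finset.Ico (q n) (q (n+1)), d (φ n) i • u i - r n • u (q n) := by
    intro n
    rw [Finset.sum_congr rfl (fun i hi => by rw [ha n i hi, sub_smul, ite_smul, zero_smul]),
      Finset.sum_sub_distrib, Finset.sum_ite_eq', if_pos (hqmem n)]
  have hu := james_norm_u hn hJ
  have hr : ∀ n, |r n| ≤ 2 * (1/2:ℝ)^n := by
    intro n
    have h1 := lc_eq (fun _ : ℕ => (1:ℝ)) (d (φ n)) _ (hsupp n)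
    rw [← Finset.sum_Ico_consecutive _ (Nat.zero_le _) (hq.monotone (Nat.le_succ n))] at h1
    simp only [smul_eq_mul, mul_one] at h1
    have h2 : r n = Finsupp.linearCombination ℝ (fun _ : ℕ => (1:ℝ)) (d (φ n)) -
        ∑ i ∈ Finset.Ico 0 (q n), d (φ n) i := by rw [h1]; simp [r]
    have h3 := Finset.abs_sum_le_sum_abs (fun i => d (φ n) i) (Finset.Ico 0 (q n))
    rw [h2]
    have h4 := abs_sub (Finsupp.linearCombination ℝ (fun _ : ℕ => (1:ℝ)) (d (φ n)))
        (∑ i ∈ Finset.Ico 0 (q n), d (φ n) i)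
    linarith [P1 n, P2 n]
  have herr : ∀ n, ‖Finsupp.linearCombination ℝ u (d (φ n)) -
      ∑ i ∈ Finset.Ico (q n) (q (n+1)), a i • u i‖ ≤ 3 * (1/2:ℝ)^n := by
    intro n
    rw [lc_eq u _ _ (hsupp n), hv,
      ← Finset.sum_Ico_consecutive _ (Nat.zero_le _) (hq.monotone (Nat.le_succ n))]
    have h1 : ∀ x y z : X, x + y - (y - z) = x + z := fun x y z => by abel
    rw [h1]
    have h2 : ‖∑ i ∈ Finset.Ico 0 (q n), d (φ n) i • u i‖ ≤ (1/2:ℝ)^n := by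
      refine le_trans ((norm_sum_le _ _).trans (Finset.sum_le_sum fun i _ => ?_)) (P1 n)
      rw [norm_smul, Real.norm_eq_abs]
      exact mul_le_of_le_one_right (abs_nonneg _) (hu i)
    have h3 : ‖r n • u (q n)‖ ≤ 2 * (1/2:ℝ)^n := by
      rw [norm_smul, Real.norm_eq_abs]
      exact (mul_le_of_le_one_right (abs_nonneg _) (hu _)).trans (hr n)
    exact (norm_add_le _ _).trans (by linarith)
  have hM0 : 0 ≤ M := (norm_nonneg _).trans (hM 0)
  have hvb : ∀ n, ‖∑ i ∈ Finset.Ico (q n) (q (n+1)), a i • u i‖ ≤ M + 3 := by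
    intro n
    have h1 := norm_sub_norm_le (∑ i ∈ Finset.Ico (q n) (q (n+1)), a i • u i)
      (Finsupp.linearCombination ℝ u (d (φ n)))
    rw [norm_sub_rev] at h1
    have h2 : ((1:ℝ)/2)^n ≤ 1 := pow_le_one₀ (by norm_num) (by norm_num)
    linarith [herr n, hM (φ n)]
  have hM3 : 0 < M + 3 := by linarith
  have hdom := james_upper hK hn hrd hblock hJ q hq q0 (fun i => (M+3)⁻¹ * a i)
    (fun n => by rw [← Finset.mul_sum, hz, mul_zero])
    (fun n => by
      simp only [mul_smul, ← Finset.smul_sum]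
      rw [norm_smul, norm_inv, Real.norm_eq_abs, abs_of_pos hM3, inv_mul_le_iff₀ hM3, mul_one]
      exact hvb n)
  have hdom2 : Dominates e (fun n => ∑ i ∈ Finset.Ico (q n) (q (n+1)), a i • u i) := by
    obtain ⟨C, hC⟩ := hdom
    refine ⟨(M+3) * C, fun s b => ?_⟩
    have := hC s b
    simp only [mul_smul, ← Finset.smul_sum, smul_comm _ ((M+3)⁻¹)] at this
    rw [norm_smul, norm_inv, Real.norm_eq_abs, abs_of_pos hM3, inv_mul_le_iff₀ hM3] at this
    rw [mul_assoc]
    exact this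
  exact dom_perturb hK hn hdom2 3 herr

lemma james_diff [CompleteSpace E] {e : ℕ → E} {u : ℕ → X} {K : ℝ} (hK : UBd e K)
    (hn : ∀ i, ‖e i‖ = 1) (hrd : RightDominantBound e)
    (hblock : ∀ v : ℕ → E, IsBlockBasis e v → (∀ n, ‖v n‖ = 1) → Dominates e v)
    (hJ : IsJamesSpace e u) (y : ℕ → X) (M : ℝ) (hM : ∀ k, ‖y k‖ ≤ M) :
    ∃ α β : ℕ → ℕ, StrictMono β ∧ (∀ k, α k < β k) ∧
      Dominates e (fun k => y (β k) - y (α k)) := by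
  classical
  set J := Finsupp.linearCombination ℝ u with hJdef
  set σ := Finsupp.linearCombination ℝ (fun _ : ℕ => (1:ℝ)) with hσ
  have happ : ∀ k, ∃ a : ℕ →₀ ℝ, ‖y k - J a‖ < (1/2:ℝ)^k := by
    intro k
    obtain ⟨x, hx, hxy⟩ := Metric.mem_closure_iff.1 (hJ.1 (y k)) ((1/2:ℝ)^k) (by positivity)
    obtain ⟨a, ha⟩ := Finsupp.mem_span_range_iff_exists_finsupp.1 hx
    refine ⟨a, ?_⟩
    rw [hJdef, Finsupp.linearCombination_apply, ha, ← dist_eq_norm]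
    exact hxy
  choose a ha using happ
  have hJa : ∀ k, ‖J (a k)‖ ≤ M + 1 := by
    intro k
    have h1 := norm_sub_norm_le (J (a k)) (y k)
    rw [norm_sub_rev] at h1
    have h2 : ((1:ℝ)/2)^k ≤ 1 := pow_le_one₀ (by norm_num) (by norm_num)
    linarith [ha k, hM k]
  have hpart : ∀ k m, |∑ j ∈ Finset.Ico 0 m, a k j| ≤ M + 1 := by
    intro k m
    refine (james_partial hn hJ (a k).support (a k) (fun i hi => by simpa using hi) m).trans ?_
    rw [← lc_eq u (a k) _ le_rfl]
    exact hJa k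
  have hcoord : ∀ k j, |a k j| ≤ 2 * (M + 1) := by
    intro k j
    have h1 := hpart k j
    have h2 := hpart k (j+1)
    rw [Finset.sum_Ico_succ_top (Nat.zero_le _)] at h2
    rw [abs_le] at *
    constructor <;> linarith
  have hsig : ∀ k, |σ (a k)| ≤ M + 1 := by
    intro k
    have h1 := hpart k ((a k).support.sup id + 1)
    rw [hσ, lc_eq _ (a k) (Finset.Ico 0 ((a k).support.sup id + 1)) (fun i hi => by
      simpa using Nat.lt_succ_of_le (Finset.le_sup (f := id) hi))]
    simpa using h1
  have hcpt : IsCompact ((Set.pi Set.univ (fun _ : ℕ => Set.Icc (-(2*(M+1))) (2*(M+1)))) ×ˢ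
      (Set.Icc (-(M+1)) (M+1))) :=
    (isCompact_univ_pi (fun _ => isCompact_Icc)).prod isCompact_Icc
  obtain ⟨l, -, ψ, hψ, hlim⟩ := hcpt.tendsto_subseq
    (x := fun k => ((fun j => a k j : ℕ → ℝ), σ (a k)))
    (fun k => ⟨fun j _ => abs_le.1 (hcoord k j), abs_le.1 (hsig k)⟩)
  have hl1 : ∀ j, Tendsto (fun k => a (ψ k) j) atTop (𝓝 (l.1 j)) := fun j =>
    ((continuous_apply j).tendsto _).comp ((continuous_fst.tendsto _).comp hlim)
  have hl2 : Tendsto (fun k => σ (a (ψ k))) atTop (𝓝 l.2) :=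
    (continuous_snd.tendsto _).comp hlim
  have t1 : Tendsto (fun k : ℕ => 2 * k + 1) atTop atTop :=
    tendsto_atTop_mono (fun k => by simp; omega) tendsto_id
  have t0 : Tendsto (fun k : ℕ => 2 * k) atTop atTop :=
    tendsto_atTop_mono (fun k => by simp; omega) tendsto_id
  obtain ⟨θ, hθ, hdom⟩ := james_null_sub hK hn hrd hblock hJ
    (fun k => a (ψ (2*k+1)) - a (ψ (2*k))) ((M+1) + (M+1))
    (fun k => by
      rw [map_sub]
      exact (norm_sub_le _ _).trans (add_le_add (hJa _) (hJa _)))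
    (fun j => by
      have := ((hl1 j).comp t1).sub ((hl1 j).comp t0)
      simpa using this)
    (by
      have := (hl2.comp t1).sub (hl2.comp t0)
      simpa using this)
  refine ⟨fun k => ψ (2 * θ k), fun k => ψ (2 * θ k + 1), ?_, ?_, ?_⟩
  · intro i j hij
    have := hθ hij
    exact hψ (by omega)
  · intro k
    exact hψ (Nat.lt_succ_self _)
  · refine dom_perturb hK hn hdom 2 fun k => ?_
    simp only [map_sub]
    have h1 : ∀ m, k ≤ m → ‖y m - J (a m)‖ ≤ (1/2:ℝ)^k := fun m hm =>
      (ha m).le.trans (pow_le_pow_of_le_one (by norm_num) (by norm_num) hm)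
    have hk : k ≤ θ k := hθ.id_le k
    have g1 : 2 * θ k ≤ ψ (2 * θ k) := hψ.id_le _
    have g2 : 2 * θ k + 1 ≤ ψ (2 * θ k + 1) := hψ.id_le _
    have i1 := h1 (ψ (2 * θ k)) (by omega)
    have i2 := h1 (ψ (2 * θ k + 1)) (by omega)
    have h2 : ∀ p q r s : X, p - q - (r - s) = (p - r) - (q - s) := fun p q r s => by abel
    rw [h2]
    exact (norm_sub_le _ _).trans (by linarith)

end seqs

section final

lemma dom_dual {e : ℕ → E} {K : ℝ} (hK : UBd e K)
    (hdense : Dense (Submodule.span ℝ (Set.range e) : Set E))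
    (e' : ℕ → E →L[ℝ] ℝ) (he' : ∀ i j, e' i (e j) = if i = j then 1 else 0)
    (B : ℝ) (hB0 : 0 ≤ B) (hB : ∀ (s : Finset ℕ) (a b : ℕ → ℝ),
      ∑ i ∈ s, a i * b i ≤ B * ‖∑ i ∈ s, a i • e i‖ * ‖∑ i ∈ s, b i • e i‖) :
    Dominates e e' := by
  classical
  have hK0 : 0 ≤ K := zero_le_one.trans hK.1
  refine ⟨B * K, fun s a => ?_⟩
  have key : ∀ x : E, ‖(∑ i ∈ s, a i • e' i) x‖ ≤ B * K * ‖∑ i ∈ s, a i • e i‖ * ‖x‖ := by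
    have hcl : IsClosed {x : E | ‖(∑ i ∈ s, a i • e' i) x‖ ≤
        B * K * ‖∑ i ∈ s, a i • e i‖ * ‖x‖} :=
      isClosed_le (ContinuousLinearMap.continuous _).norm (continuous_const.mul continuous_norm)
    have hsub : (Submodule.span ℝ (Set.range e) : Set E) ⊆ {x : E | ‖(∑ i ∈ s, a i • e' i) x‖ ≤
        B * K * ‖∑ i ∈ s, a i • e i‖ * ‖x‖} := by
      intro x hx
      obtain ⟨c, rfl⟩ := (Finsupp.mem_span_range_iff_exists_finsupp).1 hx
      have h1 : (∑ i ∈ s, a i • e' i) (c.sum fun i a => a • e i) = ∑ i ∈ s, a i * c i := by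
        rw [ContinuousLinearMap.sum_apply]
        refine Finset.sum_congr rfl fun i _ => ?_
        rw [Finsupp.sum, ContinuousLinearMap.smul_apply, map_sum]
        simp only [map_smul, he', smul_eq_mul]
        congr 1
        simp [Finset.sum_ite_eq]
        intro h; rw [h]
      have h2 : ‖∑ i ∈ s, c i • e i‖ ≤ K * ‖c.sum fun i a => a • e i‖ :=
        hK.le s c.support c c (fun i _ hi => by simpa using hi) (fun i _ => le_rfl)
      have h3 := hB s a c
      have h4 := hB s a (fun i => - c i)
      simp only [mul_neg, Finset.sum_neg_distrib, neg_smul, norm_neg] at h4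
      have h5 : B * ‖∑ i ∈ s, a i • e i‖ * ‖∑ i ∈ s, c i • e i‖ ≤
          B * ‖∑ i ∈ s, a i • e i‖ * (K * ‖c.sum fun i a => a • e i‖) :=
        mul_le_mul_of_nonneg_left h2 (by positivity)
      change ‖_‖ ≤ _
      rw [h1, Real.norm_eq_abs, abs_le]
      constructor <;> linarith
    intro x
    exact hcl.closure_subset_iff.2 hsub (hdense x)
  exact ContinuousLinearMap.opNorm_le_bound _ (by positivity) key

lemma dom_null [CompleteSpace E] {e : ℕ → E} {K : ℝ} (hK : UBd e K) (hn : ∀ i, ‖e i‖ = 1)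
    (hblock : ∀ v : ℕ → E, IsBlockBasis e v → (∀ n, ‖v n‖ = 1) → Dominates e v)
    (hdense : Dense (Submodule.span ℝ (Set.range e) : Set E))
    (e' : ℕ → E →L[ℝ] ℝ) (he' : ∀ i j, e' i (e j) = if i = j then 1 else 0)
    (hnd : ¬ Dominates e e') {F : Type*} [NormedAddCommGroup F] [NormedSpace ℝ F]
    {z : ℕ → F} (hz : Dominates e z) (f : F →L[ℝ] ℝ) :
    Tendsto (fun k => f (z k)) atTop (𝓝 0) := by
  classical
  have hK0 : 0 ≤ K := zero_le_one.trans hK.1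
  by_contra hcon
  rw [Metric.tendsto_atTop] at hcon
  push Not at hcon
  obtain ⟨ε, hε, hc⟩ := hcon
  obtain ⟨φ, hφ, hφε⟩ := extraction_of_frequently_atTop
    (P := fun k => ε ≤ |f (z k)|) (frequently_atTop.2 fun N => by
      obtain ⟨n, h1, h2⟩ := hc N
      exact ⟨n, h1, by simpa [Real.dist_eq] using h2⟩)
  obtain ⟨C, hC0, hC⟩ := (dom_sub hK hn hblock hz φ hφ).nn
  have hl1 : ∀ (s : Finset ℕ) (b : ℕ → ℝ),
      ∑ i ∈ s, |b i| ≤ ‖f‖ * (C * (K * (1/ε))) * ‖∑ i ∈ s, b i • e i‖ := by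
    intro s b
    have hne : ∀ i, f (z (φ i)) ≠ 0 := fun i h => by
      have := hφε i
      rw [h, abs_zero] at this
      linarith
    have h1 : ∑ i ∈ s, |b i| = f (∑ i ∈ s, (|b i| / f (z (φ i))) • z (φ i)) := by
      rw [map_sum]
      refine Finset.sum_congr rfl fun i _ => ?_
      rw [map_smul, smul_eq_mul, div_mul_cancel₀ _ (hne i)]
    have h2 := hK.leM s b (fun i => |b i| / f (z (φ i))) (1/ε) (by positivity) (fun i _ => by
      rw [abs_div, abs_abs, div_mul_eq_mul_div, one_mul]
      exact div_le_div_of_nonneg_left (abs_nonneg _) hε (hφε i))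
    rw [h1]
    calc _ ≤ ‖f‖ * ‖∑ i ∈ s, (|b i| / f (z (φ i))) • z (φ i)‖ :=
          (le_abs_self _).trans (f.le_opNorm _)
      _ ≤ ‖f‖ * (C * (K * (1/ε) * ‖∑ i ∈ s, b i • e i‖)) := by
          refine mul_le_mul_of_nonneg_left ?_ (norm_nonneg _)
          exact (hC s _).trans (mul_le_mul_of_nonneg_left h2 hC0)
      _ = _ := by ring
  refine hnd (dom_dual hK hdense e' he' (‖f‖ * (C * (K * (1/ε))) * K) (by positivity) ?_)
  intro s a b
  calc ∑ i ∈ s, a i * b i ≤ ∑ i ∈ s, |a i| * (K * ‖∑ i ∈ s, b i • e i‖) := by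
        refine Finset.sum_le_sum fun i hi => ?_
        refine (le_abs_self _).trans ?_
        rw [abs_mul]
        exact mul_le_mul_of_nonneg_left (hK.coef hn s b i hi) (abs_nonneg _)
    _ = (∑ i ∈ s, |a i|) * (K * ‖∑ i ∈ s, b i • e i‖) := by rw [Finset.sum_mul]
    _ ≤ (‖f‖ * (C * (K * (1/ε))) * ‖∑ i ∈ s, a i • e i‖) * (K * ‖∑ i ∈ s, b i • e i‖) :=
        mul_le_mul_of_nonneg_right (hl1 s a) (by positivity)
    _ = _ := by ring

lemma signs {Y X : Type*} [NormedAddCommGroup Y] [NormedSpace ℝ Y]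
    [NormedAddCommGroup X] [NormedSpace ℝ X] (T : Y →L[ℝ] (X →L[ℝ] ℝ))
    (y : ℕ → Y) (x : ℕ → X) (s : Finset ℕ) : ∃ ε : ℕ → ℝ, (∀ i, |ε i| = 1) ∧
      ∑ i ∈ s, T (y i) (x i) ≤ T (∑ i ∈ s, ε i • y i) (∑ i ∈ s, ε i • x i) := by
  classical
  induction s using Finset.induction_on with
  | empty => exact ⟨fun _ => 1, by simp, by simp⟩
  | insert i s hi ih =>
    obtain ⟨ε, h1, h2⟩ := ih
    have hne : ∀ j ∈ s, j ≠ i := fun j hj h => hi (h ▸ hj)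
    have key : ∀ η : ℝ, |η| = 1 → (∀ j, |Function.update ε i η j| = 1) ∧
        T (∑ j ∈ insert i s, Function.update ε i η j • y j)
          (∑ j ∈ insert i s, Function.update ε i η j • x j) =
        T (η • y i + ∑ j ∈ s, ε j • y j) (η • x i + ∑ j ∈ s, ε j • x j) := by
      intro η hη
      refine ⟨fun j => ?_, ?_⟩
      · by_cases h : j = i
        · subst h; simpa using hη
        · simpa [Function.update_of_ne h] using h1 j
      · rw [Finset.sum_insert hi, Finset.sum_insert hi]
        simp only [Function.update_self]
        rw [Finset.sum_congr rfl fun j hj => by rw [Function.update_of_ne (hne j hj)],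
          Finset.sum_congr (g := fun j => ε j • x j) rfl
            fun j hj => by rw [Function.update_of_ne (hne j hj)]]
    set P := ∑ j ∈ s, ε j • y j
    set Q := ∑ j ∈ s, ε j • x j
    rw [Finset.sum_insert hi]
    by_cases hs : 0 ≤ T (y i) Q + T P (x i)
    · refine ⟨Function.update ε i 1, (key 1 (by simp)).1, ?_⟩
      rw [(key 1 (by simp)).2]
      simp only [one_smul, map_add, ContinuousLinearMap.add_apply]
      linarith
    · refine ⟨Function.update ε i (-1), (key (-1) (by simp)).1, ?_⟩
      rw [(key (-1) (by simp)).2]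
      simp only [neg_smul, one_smul, map_add, map_neg, ContinuousLinearMap.add_apply,
        ContinuousLinearMap.neg_apply]
      linarith

lemma ext_op {A B : Type*} [NormedAddCommGroup A] [NormedSpace ℝ A] [NormedAddCommGroup B]
    [NormedSpace ℝ B] [CompleteSpace B] {x : ℕ → A} {y : ℕ → B}
    (hd : Dense (Submodule.span ℝ (Set.range x) : Set A)) (h : Dominates x y) :
    ∃ T : A →L[ℝ] B, ∀ i, T (x i) = y i := by
  obtain ⟨C, hC⟩ := h
  let f := Finsupp.linearCombination ℝ y
  let g := Finsupp.linearCombination ℝ x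
  have h1 : DenseRange g := by
    rw [← Finsupp.range_linearCombination] at hd
    exact hd
  have h2 : ∃ C : ℝ, ∀ c, ‖f c‖ ≤ C * ‖g c‖ := ⟨C, fun c => by
    simpa [f, g, Finsupp.linearCombination_apply, Finsupp.sum] using hC c.support c⟩
  refine ⟨f.extendOfNorm g, fun i => ?_⟩
  have := LinearMap.extendOfNorm_eq h1 h2 (Finsupp.single i 1)
  simpa [f, g] using this

lemma part_ab [CompleteSpace E] {X : Type*} [NormedAddCommGroup X] [NormedSpace ℝ X]
    {e : ℕ → E} (hn : ∀ i, ‖e i‖ = 1)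
    (hdense : Dense (Submodule.span ℝ (Set.range e) : Set E))
    (e' : ℕ → E →L[ℝ] ℝ) (he' : ∀ i j, e' i (e j) = if i = j then 1 else 0)
    {u : ℕ → X} (hJ : IsJamesSpace e u) (hd : Dominates e e') :
    ∃ T : X →L[ℝ] (X →L[ℝ] ℝ), ∀ i j, T (u i) (u j) = if i = j then 1 else 0 := by
  classical
  have hue : Dominates u e := by
    refine ⟨1, fun s a => ?_⟩
    rw [one_mul]
    have hsub : s ⊆ Finset.range (s.sup id + 1) := fun i hi =>
      Finset.mem_range.2 (Nat.lt_succ_of_le (Finset.le_sup (f := id) hi))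
    have := james_ge_e hn hJ (s.sup id + 1) (fun i => if i ∈ s then a i else 0) (fun i hi => by
      have : i ∉ s := fun h => by
        have := Finset.mem_range.1 (hsub h)
        omega
      simp [this])
    simpa [ite_smul, Finset.sum_ite_mem, Finset.inter_eq_right.2 hsub] using this
  obtain ⟨R, hR⟩ := ext_op hJ.1 hue
  obtain ⟨Q, hQ⟩ := ext_op hdense hd
  refine ⟨((ContinuousLinearMap.compL ℝ X E ℝ).flip R).comp (Q.comp R), fun i j => ?_⟩
  simp [hR, hQ, he']

/-- A non-compact operator admits a separated sequence of values. -/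
lemma sep_seq {Y Z : Type*} [NormedAddCommGroup Y] [NormedSpace ℝ Y]
    [NormedAddCommGroup Z] [NormedSpace ℝ Z] [CompleteSpace Z] (T : Y →L[ℝ] Z)
    (h : ¬ IsCompactOp T) : ∃ δ > 0, ∃ y : ℕ → Y, (∀ k, ‖y k‖ ≤ 1) ∧
      ∀ k l, k < l → δ ≤ ‖T (y l) - T (y k)‖ := by
  classical
  have htb : ¬ TotallyBounded (T '' Metric.closedBall 0 1) := fun hc =>
    h (isCompact_iff_totallyBounded_isComplete.2 ⟨hc.closure, isClosed_closure.isComplete⟩)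
  rw [Metric.totallyBounded_iff] at htb
  push Not at htb
  obtain ⟨δ, hδ, hT⟩ := htb
  obtain ⟨y, hy1, hy2⟩ := exists_seq_of_forall_finset_exists
    (fun y : Y => ‖y‖ ≤ 1) (fun y y' => δ ≤ ‖T y' - T y‖) (fun s _ => by
      have := hT (T '' (s : Set Y)) (s.finite_toSet.image _)
      rw [Set.not_subset] at this
      obtain ⟨_, ⟨y, hy, rfl⟩, hy2⟩ := this
      refine ⟨y, by simpa using hy, fun x hx => ?_⟩
      by_contra hcon
      push Not at hcon
      refine hy2 (Set.mem_iUnion₂.2 ⟨T x, ⟨x, hx, rfl⟩, ?_⟩)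
      rwa [Metric.mem_ball, dist_eq_norm])
  exact ⟨δ, hδ, y, hy1, fun k l hkl => hy2 k l hkl⟩

lemma part_ba [CompleteSpace E] {X : Type*} [NormedAddCommGroup X] [NormedSpace ℝ X]
    {e : ℕ → E} {K : ℝ} (hK : UBd e K) (hn : ∀ i, ‖e i‖ = 1)
    (hrd : RightDominantBound e)
    (hblock : ∀ v : ℕ → E, IsBlockBasis e v → (∀ n, ‖v n‖ = 1) → Dominates e v)
    (hdense : Dense (Submodule.span ℝ (Set.range e) : Set E))
    (e' : ℕ → E →L[ℝ] ℝ) (he' : ∀ i j, e' i (e j) = if i = j then 1 else 0)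
    {u : ℕ → X} (hJ : IsJamesSpace e u) (hnd : ¬ Dominates e e')
    (Y : Submodule ℝ X) (T : Y →L[ℝ] (X →L[ℝ] ℝ)) : IsCompactOp T := by
  classical
  have hK0 : 0 ≤ K := zero_le_one.trans hK.1
  by_contra hT
  obtain ⟨δ, hδ, y, hy1, hy2⟩ := sep_seq T hT
  obtain ⟨α, β, -, hαβ, hdz⟩ := james_diff hK hn hrd hblock hJ (fun k => (y k : X)) 1
    (fun k => by simpa using hy1 k)
  let z : ℕ → Y := fun k => y (β k) - y (α k)
  have hz : Dominates e z := by
    obtain ⟨C, hC⟩ := hdz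
    refine ⟨C, fun s a => ?_⟩
    have := hC s a
    have h2 : ((∑ i ∈ s, a i • z i : Y) : X) =
        ∑ i ∈ s, a i • ((y (β i) : X) - (y (α i) : X)) := by
      simp [z]
    change ‖((∑ i ∈ s, a i • z i : Y) : X)‖ ≤ _
    rw [h2]
    exact this
  have hTz : ∀ k, δ ≤ ‖T (z k)‖ := fun k => by
    simp only [z, map_sub]
    exact hy2 _ _ (hαβ k)
  have hx : ∀ k, ∃ x : X, ‖x‖ ≤ 1 ∧ δ / 2 < T (z k) x := by
    intro k
    by_contra hcon
    push Not at hcon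
    have : ‖T (z k)‖ ≤ δ / 2 := by
      refine ContinuousLinearMap.opNorm_le_of_unit_norm (by positivity) fun x hx => ?_
      have h1 := hcon x hx.le
      have h2 := hcon (-x) (by rw [norm_neg]; exact hx.le)
      rw [map_neg] at h2
      rw [Real.norm_eq_abs, abs_le]
      constructor <;> linarith
    linarith [hTz k]
  choose x hx1 hx2 using hx
  have hnull : ∀ w : X, Tendsto (fun k => T (z k) w) atTop (𝓝 0) := fun w =>
    dom_null hK hn hblock hdense e' he' hnd hz (T.flip w)
  obtain ⟨φ, -, hφ⟩ := exists_seq_of_forall_finset_exists (fun _ : ℕ => True)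
    (fun m n => m < n ∧ |T (z n) (x m)| < δ / 4) (fun s _ => by
      have : ∀ᶠ n in atTop, ∀ m ∈ s, m < n ∧ |T (z n) (x m)| < δ / 4 := by
        rw [Filter.eventually_all_finset]
        intro m _
        refine (eventually_gt_atTop m).and ?_
        have := (hnull (x m)).abs
        rw [abs_zero] at this
        exact this.eventually_lt_const (by positivity)
      obtain ⟨n, hn⟩ := this.exists
      exact ⟨n, trivial, hn⟩)
  have hφm : StrictMono φ := fun m n h => (hφ m n h).1
  obtain ⟨α', β', hβ', hαβ', hdw⟩ := james_diff hK hn hrd hblock hJ (fun k => x (φ k)) 1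
    (fun k => hx1 _)
  set w : ℕ → X := fun k => x (φ (β' k)) - x (φ (α' k)) with hw
  obtain ⟨C', hC'0, hC'⟩ := hdw.nn
  obtain ⟨C, hC0, hC⟩ := (dom_sub hK hn hblock hz (fun k => φ (β' k)) (hφm.comp hβ')).nn
  have hfw : ∀ k, δ / 4 ≤ T (z (φ (β' k))) (w k) := by
    intro k
    have h1 := hx2 (φ (β' k))
    have h2 := (hφ _ _ (hαβ' k)).2
    rw [abs_lt] at h2
    simp only [hw, map_sub]
    linarith
  refine hnd (dom_dual hK hdense e' he' (‖T‖ * (C * K) * (C' * (K * (4/δ)))) (by positivity) ?_)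
  intro s a b
  let c : ℕ → ℝ := fun j => b j / T (z (φ (β' j))) (w j)
  obtain ⟨ε, hε, hs⟩ := signs T (fun j => a j • z (φ (β' j))) (fun j => c j • w j) s
  have hpos : ∀ j, 0 < T (z (φ (β' j))) (w j) := fun j => by linarith [hfw j]
  have h1 : ∑ j ∈ s, a j * b j = ∑ j ∈ s, T (a j • z (φ (β' j))) (c j • w j) := by
    refine Finset.sum_congr rfl fun j _ => ?_
    simp only [map_smul, c, smul_eq_mul, FunLike.coe_smul, Pi.smul_apply]
    have := (hpos j).ne'
    field_simp
  simp only [smul_smul] at hs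
  have n1 : ‖∑ j ∈ s, (ε j * a j) • z (φ (β' j))‖ ≤ C * K * ‖∑ j ∈ s, a j • e j‖ := by
    have h2 := hK.leM s a (fun j => ε j * a j) 1 zero_le_one (fun j _ => by
      rw [abs_mul, hε])
    rw [mul_one] at h2
    calc _ ≤ C * ‖∑ j ∈ s, (ε j * a j) • e j‖ := hC s _
      _ ≤ C * (K * ‖∑ j ∈ s, a j • e j‖) := mul_le_mul_of_nonneg_left h2 hC0
      _ = _ := by ring
  have n2 : ‖∑ j ∈ s, (ε j * c j) • w j‖ ≤ C' * (K * (4/δ)) * ‖∑ j ∈ s, b j • e j‖ := by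
    have h2 := hK.leM s b (fun j => ε j * c j) (4/δ) (by positivity) (fun j _ => by
      rw [abs_mul, hε, one_mul]
      simp only [c]
      rw [abs_div, abs_of_pos (hpos j), div_le_iff₀ (hpos j)]
      have h3 : 1 ≤ 4 / δ * T (z (φ (β' j))) (w j) := by
        have := mul_le_mul_of_nonneg_left (hfw j) (show 0 ≤ 4 / δ by positivity)
        have h4 : 4 / δ * (δ / 4) = 1 := by field_simp
        linarith
      nlinarith [abs_nonneg (b j)])
    calc _ ≤ C' * ‖∑ j ∈ s, (ε j * c j) • e j‖ := hC' s _
      _ ≤ C' * (K * (4/δ) * ‖∑ j ∈ s, b j • e j‖) := mul_le_mul_of_nonneg_left h2 hC'0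
      _ = _ := by ring
  rw [h1]
  refine hs.trans ((le_abs_self _).trans ((T.le_opNorm₂ _ _).trans ?_))
  calc _ ≤ ‖T‖ * (C * K * ‖∑ j ∈ s, a j • e j‖) *
        (C' * (K * (4/δ)) * ‖∑ j ∈ s, b j • e j‖) := by gcongr
    _ = _ := by ring

end final

end helpers

/-- Theorem 3 of the paper. -/
theorem statement2 {E X : Type*} [NormedAddCommGroup E] [NormedSpace ℝ E] [CompleteSpace E]
    [NormedAddCommGroup X] [NormedSpace ℝ X] [CompleteSpace X]
    (e : ℕ → E) (hdense : Dense (Submodule.span ℝ (Set.range e) : Set E))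
    (he : IsNormalizedUnconditionalBasic e) (hrd : RightDominantBound e)
    (hblock : ∀ v : ℕ → E, IsBlockBasis e v → (∀ n, ‖v n‖ = 1) → Dominates e v)
    (e' : ℕ → E →L[ℝ] ℝ) (he' : ∀ i j, e' i (e j) = if i = j then 1 else 0)
    (u : ℕ → X) (hJ : IsJamesSpace e u) :
    (∀ Y : Submodule ℝ X, IsClosed (Y : Set X) →
        ∀ T : Y →L[ℝ] (X →L[ℝ] ℝ), IsCompactOp T) ↔
      ¬ Dominates e e' := by
  obtain ⟨K, hK⟩ := exists_UBd e he
  have hn := he.1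
  constructor
  · intro h hd
    obtain ⟨T, hT⟩ := part_ab hn hdense e' he' hJ hd
    have hc := h ⊤ isClosed_univ (T.comp (Submodule.subtypeL ⊤))
    have hmem : ∀ i, T (u i) ∈
        closure ((T.comp (Submodule.subtypeL ⊤)) '' Metric.closedBall (0 : (⊤ : Submodule ℝ X)) 1) :=
      fun i => subset_closure ⟨⟨u i, trivial⟩, by simpa using james_norm_u hn hJ i, rfl⟩
    obtain ⟨l, -, φ, hφ, hl⟩ := IsCompact.tendsto_subseq hc hmem
    obtain ⟨N, hN⟩ := Metric.cauchySeq_iff.1 hl.cauchySeq 1 one_pos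
    have h1 := hN N le_rfl (N+1) (Nat.le_succ N)
    rw [dist_eq_norm] at h1
    have h2 := (T (u (φ N)) - T (u (φ (N+1)))).le_opNorm (u (φ N))
    have h3 : (T (u (φ N)) - T (u (φ (N+1)))) (u (φ N)) = 1 := by
      have : φ (N+1) ≠ φ N := (hφ (Nat.lt_succ_self N)).ne'
      simp [hT, this]
    rw [h3, norm_one] at h2
    have h4 := james_norm_u hn hJ (φ N)
    have h5 := mul_le_mul_of_nonneg_left h4 (norm_nonneg (T (u (φ N)) - T (u (φ (N+1)))))
    simp only [Function.comp_apply] at h1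
    linarith
  · intro hnd Y _ T
    exact part_ba hK hn hrd hblock hdense e' he' hJ hnd Y T
end
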